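/- Let n ≥ 3 and let Φ be a continuous translation invariant Minkowski valuation on convex bodies in an n-dimensional Euclidean vector space. If Φ is SO(n)-equivariant, i.e. Φ(ϑK) = ϑΦ(K) for all K ∈ K^n and ϑ ∈ SO(n), then Φ is also O(n)-equivariant, i.e. Φ(ϑK) = ϑΦ(K) for all K ∈ K^n and ϑ ∈ O(n). -/

import Mathlib

open scoped Pointwise NNReal
noncomputable section

abbrev En (n : ℕ) : Type := EuclideanSpace ℝ (Fin n)
abbrev Body (n : ℕ) : Type := ConvexBody (En n)

/-- The special orthogonal group `SO(n)`, as a subgroup of the orthogonal group. -/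
def SOGroup (n : ℕ) : Subgroup (Matrix.orthogonalGroup (Fin n) ℝ) where
  carrier := {g | Matrix.det (g : Matrix (Fin n) (Fin n) ℝ) = 1}
  one_mem' := by simp
  mul_mem' := by
    intro a b ha hb
    simp only [Set.mem_setOf_eq] at *
    rw [Submonoid.coe_mul, Matrix.det_mul, ha, hb, mul_one]
  inv_mem' := by
    intro a ha
    simp only [Set.mem_setOf_eq] at *
    have h : ((a * a⁻¹ : Matrix.orthogonalGroup (Fin n) ℝ) : Matrix (Fin n) (Fin n) ℝ) = 1 := by
      rw [mul_inv_cancel]; rfl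
    rw [Submonoid.coe_mul] at h
    have h2 := congrArg Matrix.det h
    rw [Matrix.det_mul, ha, one_mul, Matrix.det_one] at h2
    exact h2

/-- The underlying matrix of an element of `O(n)`. -/
def OMat {n : ℕ} (g : Matrix.orthogonalGroup (Fin n) ℝ) : Matrix (Fin n) (Fin n) ℝ := g

/-- The underlying matrix of an element of `SO(n)`. -/
def SOMat {n : ℕ} (g : SOGroup n) : Matrix (Fin n) (Fin n) ℝ := ((g : Matrix.orthogonalGroup (Fin n) ℝ) : Matrix (Fin n) (Fin n) ℝ)

def mapBody {n : ℕ} (A : Matrix (Fin n) (Fin n) ℝ) (K : Body n) : Body n where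
  carrier := (Matrix.toEuclideanLin A) '' (K : Set (En n))
  convex' := K.convex.linear_image _
  isCompact' := K.isCompact.image (LinearMap.continuous_of_finiteDimensional _)
  nonempty' := K.nonempty.image _

/-- Rotation of a convex body by an element of `SO(n)`. -/
def rotBody {n : ℕ} (g : SOGroup n) (K : Body n) : Body n := mapBody (SOMat g) K

/-- Rotation of a convex body by an element of `O(n)`. -/
def rotBodyO {n : ℕ} (g : Matrix.orthogonalGroup (Fin n) ℝ) (K : Body n) : Body n := mapBody (OMat g) K

/-- The natural action of `SO(n)` on complex-valued functions of convex bodies. -/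
def actVal {n : ℕ} {M : Type*} (g : SOGroup n) (φ : Body n → M) : Body n → M :=
  fun K => φ (rotBody g⁻¹ K)

/-- Volume of a convex body. -/
def bvol {n : ℕ} (K : Body n) : ℝ := (MeasureTheory.volume (K : Set (En n))).toReal

/-- The mixed volume of an `n`-tuple of convex bodies, defined through the standard
polarization formula. -/
def mixedVol {n : ℕ} (K : Fin n → Body n) : ℝ :=
  (n.factorial : ℝ)⁻¹ * ∑ S : Finset (Fin n),
    if S.Nonempty then (-1 : ℝ) ^ (n - S.card) * bvol (∑ i ∈ S, K i) else 0

/-- The Euclidean unit ball as a convex body. -/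
def unitB (n : ℕ) : Body n where
  carrier := Metric.closedBall (0 : En n) 1
  convex' := convex_closedBall _ _
  isCompact' := isCompact_closedBall _ _
  nonempty' := ⟨0, Metric.mem_closedBall_self zero_le_one⟩

/-- The `j`-th quermassintegral `W_j(K)`: the mixed volume of `n - j` copies of `K` and
`j` copies of the unit ball. -/
def quer {n : ℕ} (j : ℕ) (K : Body n) : ℝ :=
  mixedVol (fun l => if (l : ℕ) < n - j then K else unitB n)

/-- The mixed quermassintegral `W_j(K, L)`: the mixed volume of `n - 1 - j` copies of `K`,
`j` copies of the unit ball and one copy of `L`. -/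
def querM {n : ℕ} (j : ℕ) (K L : Body n) : ℝ :=
  mixedVol (fun l => if (l : ℕ) < n - 1 - j then K else if (l : ℕ) < n - 1 then unitB n else L)

/-- The volume `κ_m` of the `m`-dimensional Euclidean unit ball. -/
def kappa (m : ℕ) : ℝ := (MeasureTheory.volume (Metric.closedBall (0 : En m) 1)).toReal

/-- The `i`-th intrinsic volume, normalized by `κ_{n-i} V_i(K) = (n choose i) W_{n-i}(K)`. -/
def intrVol {n : ℕ} (i : ℕ) (K : Body n) : ℝ :=
  (n.choose i : ℝ) * quer (n - i) K / kappa (n - i)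

/-- Two convex bodies are homothetic if one is a translate of a positive dilate of the other. -/
def Homothetic {n : ℕ} (K L : Body n) : Prop :=
  ∃ (t : ℝ) (x : En n), 0 < t ∧ (L : Set (En n)) = (fun y => x + t • y) '' (K : Set (En n))

/-- A convex body with nonempty interior. -/
def HasInterior {n : ℕ} (K : Body n) : Prop := (interior (K : Set (En n))).Nonempty


/-- The translate of a convex body by a vector. -/
def transBody {n : ℕ} (x : En n) (K : Body n) : Body n where
  carrier := (fun y => x + y) '' (K : Set (En n))
  convex' := K.convex.translate x
  isCompact' := K.isCompact.image (continuous_const.add continuous_id)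
  nonempty' := K.nonempty.image _

/-- The dilate of a convex body by a real factor. -/
def scaleBody {n : ℕ} (t : ℝ) (K : Body n) : Body n where
  carrier := t • (K : Set (En n))
  convex' := K.convex.smul t
  isCompact' := K.isCompact.smul t
  nonempty' := K.nonempty.smul_set

/-- `φ` is a valuation: additive on unions of convex bodies which are again convex bodies. -/
def IsValuation {n : ℕ} {M : Type*} [Add M] (φ : Body n → M) : Prop :=
  ∀ K L U I : Body n,
    (U : Set (En n)) = (K : Set (En n)) ∪ (L : Set (En n)) →
    (I : Set (En n)) = (K : Set (En n)) ∩ (L : Set (En n)) →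
    φ K + φ L = φ U + φ I

/-- `φ` is translation invariant. -/
def IsTransInv {n : ℕ} {M : Type*} (φ : Body n → M) : Prop :=
  ∀ (x : En n) (K : Body n), φ (transBody x K) = φ K

/-- `φ` (scalar- or vector-valued) is homogeneous of degree `i`. -/
def IsHomog {n : ℕ} {M : Type*} [SMul ℝ M] (i : ℕ) (φ : Body n → M) : Prop :=
  ∀ (t : ℝ), 0 < t → ∀ K : Body n, φ (scaleBody t K) = (t ^ i : ℝ) • φ K

/-- `φ` is a continuous, translation invariant valuation. -/
def IsContTIVal {n : ℕ} {M : Type*} [Add M] [TopologicalSpace M] (φ : Body n → M) : Prop :=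
  Continuous φ ∧ IsValuation φ ∧ IsTransInv φ

/-- `φ` is a bivaluation: a valuation in each of its two arguments. -/
def IsBival {n : ℕ} {M : Type*} [Add M] (φ : Body n → Body n → M) : Prop :=
  (∀ L : Body n, IsValuation (fun K => φ K L)) ∧ (∀ K : Body n, IsValuation (φ K))

/-- `φ` is invariant under independent translations of its two arguments. -/
def IsTransBiinv {n : ℕ} {M : Type*} (φ : Body n → Body n → M) : Prop :=
  ∀ (x y : En n) (K L : Body n), φ (transBody x K) (transBody y L) = φ K L

/-- `φ` has bidegree `(i, j)`. -/
def IsBihomog {n : ℕ} {M : Type*} [SMul ℝ M] (i j : ℕ) (φ : Body n → Body n → M) : Prop :=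
  ∀ (t s : ℝ), 0 < t → 0 < s → ∀ K L : Body n,
    φ (scaleBody t K) (scaleBody s L) = (t ^ i * s ^ j : ℝ) • φ K L

/-- `φ` is `O(n)` invariant. -/
def IsOBiinv {n : ℕ} {M : Type*} (φ : Body n → Body n → M) : Prop :=
  ∀ (g : Matrix.orthogonalGroup (Fin n) ℝ) (K L : Body n), φ (rotBodyO g K) (rotBodyO g L) = φ K L

/-- `φ` is `SO(n)` invariant. -/
def IsSOBiinv {n : ℕ} {M : Type*} (φ : Body n → Body n → M) : Prop :=
  ∀ (g : SOGroup n) (K L : Body n), φ (rotBody g K) (rotBody g L) = φ K L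

/-- `φ` is jointly continuous. -/
def ContinuousBi {n : ℕ} {M : Type*} [TopologicalSpace M] (φ : Body n → Body n → M) : Prop :=
  Continuous fun p : Body n × Body n => φ p.1 p.2

/-- A continuous translation invariant Minkowski valuation which is
homogeneous of degree `i`. -/
def IsMinkValHom {n : ℕ} (i : ℕ) (Φ : Body n → Body n) : Prop :=
  Continuous Φ ∧ IsValuation Φ ∧ IsTransInv Φ ∧
    ∀ (t : ℝ), 0 < t → ∀ K : Body n, Φ (scaleBody t K) = scaleBody (t ^ i) (Φ K)

/-- A Minkowski valuation is `SO(n)` equivariant. -/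
def IsSOEquivariant {n : ℕ} (Φ : Body n → Body n) : Prop :=
  ∀ (g : SOGroup n) (K : Body n), Φ (rotBody g K) = rotBody g (Φ K)

/-- A Minkowski valuation is `O(n)` equivariant. -/
def IsOEquivariant {n : ℕ} (Φ : Body n → Body n) : Prop :=
  ∀ (g : Matrix.orthogonalGroup (Fin n) ℝ) (K : Body n), Φ (rotBodyO g K) = rotBodyO g (Φ K)

namespace BodyVal

/-- Compact convex sets, the empty set included. -/
def CC {V : Type*} [AddCommGroup V] [Module ℝ V] [TopologicalSpace V] (A : Set V) : Prop :=
  IsCompact A ∧ Convex ℝ A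

/-- Translation invariant valuations on compact convex sets, vanishing on the empty set. -/
structure IsVal {V : Type*} [AddCommGroup V] [Module ℝ V] [TopologicalSpace V]
    (ψ : Set V → ℝ) : Prop where
  empty : ψ ∅ = 0
  add : ∀ A B : Set V, CC A → CC B → Convex ℝ (A ∪ B) → ψ (A ∪ B) + ψ (A ∩ B) = ψ A + ψ B
  trans : ∀ (x : V) (A : Set V), CC A → ψ (x +ᵥ A) = ψ A

/-- Two sets are contained in the closed `δ`-neighbourhoods of each other. -/
def Near {V : Type*} [PseudoMetricSpace V] (δ : ℝ) (A B : Set V) : Prop :=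
  (∀ a ∈ A, ∃ b ∈ B, dist a b ≤ δ) ∧ (∀ b ∈ B, ∃ a ∈ A, dist a b ≤ δ)

/-- Continuous translation invariant valuations. -/
structure IsContVal {V : Type*} [NormedAddCommGroup V] [NormedSpace ℝ V]
    (ψ : Set V → ℝ) : Prop extends IsVal ψ where
  cont : ∀ A : Set V, CC A → A.Nonempty → ∀ ε > 0, ∃ δ > 0, ∀ B : Set V, CC B → B.Nonempty →
    Near δ A B → |ψ B - ψ A| < ε

/-- The reflection in the hyperplane orthogonal to the unit vector `v`. -/
def refl {V : Type*} [NormedAddCommGroup V] [InnerProductSpace ℝ V] (v : V) : V →ₗ[ℝ] V :=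
  LinearMap.id - (2 : ℝ) • (innerₛₗ ℝ v).smulRight v

/-- Continuous translation invariant valuations which vanish on points and change sign under
all reflections fixing `e`. -/
structure IsAnti {V : Type*} [NormedAddCommGroup V] [InnerProductSpace ℝ V] (e : V)
    (ψ : Set V → ℝ) : Prop extends IsContVal ψ where
  point : ψ {0} = 0
  anti : ∀ v : V, ‖v‖ = 1 → inner ℝ v e = 0 → ∀ A : Set V, CC A → ψ (refl v '' A) = - ψ A

/-- The operator measuring the failure of `ψ (2 A) = 2 ψ A`. -/
def dbl {V : Type*} [AddCommGroup V] [Module ℝ V] (ψ : Set V → ℝ) : Set V → ℝ :=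
  fun A => ψ ((2 : ℝ) • A) - 2 * ψ A

section basic

variable {V W : Type*} [NormedAddCommGroup V] [NormedSpace ℝ V] [NormedAddCommGroup W]
  [NormedSpace ℝ W]

theorem CC.inter {A B : Set V} (hA : CC A) (hB : CC B) : CC (A ∩ B) :=
  ⟨hA.1.inter hB.1, hA.2.inter hB.2⟩

theorem CC.inter_closed {A B : Set V} (hA : CC A) (hB : IsClosed B) (hB' : Convex ℝ B) :
    CC (A ∩ B) :=
  ⟨hA.1.inter_right hB, hA.2.inter hB'⟩

theorem CC.add {A B : Set V} (hA : CC A) (hB : CC B) : CC (A + B) :=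
  ⟨hA.1.add hB.1, hA.2.add hB.2⟩

theorem CC.smul {A : Set V} (hA : CC A) (c : ℝ) : CC (c • A) :=
  ⟨hA.1.smul c, hA.2.smul c⟩

theorem CC.vadd {A : Set V} (hA : CC A) (x : V) : CC (x +ᵥ A) :=
  ⟨hA.1.vadd x, hA.2.vadd x⟩

theorem CC.singleton (x : V) : CC ({x} : Set V) := ⟨isCompact_singleton, convex_singleton x⟩

theorem CC.empty : CC (∅ : Set V) := ⟨isCompact_empty, convex_empty⟩

theorem CC.image {A : Set V} (hA : CC A) (f : V →ₗ[ℝ] W) (hf : Continuous f) : CC (f '' A) :=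
  ⟨hA.1.image hf, hA.2.linear_image f⟩

theorem exists_mem_segment_inter {A B : Set V} (hA : IsClosed A) (hB : IsClosed B)
    (h : Convex ℝ (A ∪ B)) {a b : V} (ha : a ∈ A) (hb : b ∈ B) :
    ∃ z ∈ segment ℝ a b, z ∈ A ∩ B := by
  have h1 : IsPreconnected (segment ℝ a b) := (convex_segment a b).isPreconnected
  have h2 := (isPreconnected_closed_iff.1 h1) A B hA hB
    (h.segment_subset (Or.inl ha) (Or.inr hb)) ⟨a, left_mem_segment ℝ a b, ha⟩
    ⟨b, right_mem_segment ℝ a b, hb⟩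
  exact h2

theorem add_inter_of_convex_union {L A B : Set V} (hL : Convex ℝ L) (hA : IsClosed A)
    (hB : IsClosed B) (h : Convex ℝ (A ∪ B)) : L + (A ∩ B) = (L + A) ∩ (L + B) := by
  apply Set.Subset.antisymm
  · exact Set.subset_inter (Set.add_subset_add_left Set.inter_subset_left)
      (Set.add_subset_add_left Set.inter_subset_right)
  · rintro x ⟨⟨l, hl, a, ha, rfl⟩, ⟨l', hl', b, hb, hx⟩⟩
    obtain ⟨z, ⟨s, t, hs, ht, hst, rfl⟩, hz⟩ := exists_mem_segment_inter hA hB h ha hb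
    refine ⟨s • l + t • l', hL hl hl' hs ht hst, _, hz, ?_⟩
    have hx' : l' + b = l + a := hx
    calc s • l + t • l' + (s • a + t • b) = s • (l + a) + t • (l' + b) := by module
      _ = (s + t) • (l + a) := by rw [hx']; module
      _ = l + a := by rw [hst, one_smul]

theorem IsVal.add_left {ψ : Set V → ℝ} (h : IsVal ψ) {L : Set V} (hL : CC L) :
    IsVal (fun A => ψ (L + A)) where
  empty := by simp [h.empty]
  add A B hA hB hAB := by
    show ψ (L + (A ∪ B)) + ψ (L + (A ∩ B)) = ψ (L + A) + ψ (L + B)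
    rw [add_inter_of_convex_union hL.2 hA.1.isClosed hB.1.isClosed hAB, Set.add_union]
    apply h.add _ _ (hL.add hA) (hL.add hB)
    rw [← Set.add_union]
    exact hL.2.add hAB
  trans x A hA := by
    show ψ (L + (x +ᵥ A)) = ψ (L + A)
    rw [← h.trans x (L + A) (hL.add hA)]
    congr 1
    ext y
    simp only [Set.mem_add, Set.mem_vadd_set, vadd_eq_add]
    constructor
    · rintro ⟨l, hl, _, ⟨a, ha, rfl⟩, rfl⟩
      exact ⟨l + a, ⟨l, hl, a, ha, rfl⟩, by abel⟩
    · rintro ⟨_, ⟨l, hl, a, ha, rfl⟩, rfl⟩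
      exact ⟨l, hl, _, ⟨a, ha, rfl⟩, by abel⟩

theorem image_vadd_linear (f : V →ₗ[ℝ] W) (x : V) (A : Set V) :
    f '' (x +ᵥ A) = f x +ᵥ (f '' A) := by
  ext y
  simp only [Set.mem_image, Set.mem_vadd_set, vadd_eq_add]
  constructor
  · rintro ⟨_, ⟨a, ha, rfl⟩, rfl⟩
    exact ⟨f a, ⟨a, ha, rfl⟩, by simp⟩
  · rintro ⟨_, ⟨a, ha, rfl⟩, rfl⟩
    exact ⟨x + a, ⟨a, ha, rfl⟩, by simp⟩

theorem IsVal.comp_image {ψ : Set V → ℝ} (h : IsVal ψ) (f : W →ₗ[ℝ] V)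
    (hf : Function.Injective f) (hc : Continuous f) : IsVal (fun A => ψ (f '' A)) where
  empty := by simp [h.empty]
  add A B hA hB hAB := by
    show ψ (f '' (A ∪ B)) + ψ (f '' (A ∩ B)) = ψ (f '' A) + ψ (f '' B)
    rw [Set.image_inter hf, Set.image_union]
    apply h.add _ _ (hA.image f hc) (hB.image f hc)
    rw [← Set.image_union]
    exact hAB.linear_image f
  trans x A hA := by
    show ψ (f '' (x +ᵥ A)) = ψ (f '' A)
    rw [image_vadd_linear, h.trans _ _ (hA.image f hc)]

theorem IsVal.comp_smul {ψ : Set V → ℝ} (h : IsVal ψ) {c : ℝ} (hc : c ≠ 0) :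
    IsVal (fun A => ψ (c • A)) := by
  have := h.comp_image (c • (LinearMap.id : V →ₗ[ℝ] V)) (by
    intro x y hxy
    simpa [hc] using hxy) (continuous_const_smul c)
  simpa [Set.image_smul] using this

theorem IsVal.comb {ψ χ : Set V → ℝ} (h : IsVal ψ) (h' : IsVal χ) (c : ℝ) :
    IsVal (fun A => ψ A - c * χ A) where
  empty := by simp [h.empty, h'.empty]
  add A B hA hB hAB := by
    linear_combination h.add A B hA hB hAB - c * h'.add A B hA hB hAB
  trans x A hA := by rw [h.trans x A hA, h'.trans x A hA]

theorem IsVal.dbl {ψ : Set V → ℝ} (h : IsVal ψ) : IsVal (dbl ψ) :=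
  (h.comp_smul two_ne_zero).comb h 2

theorem Near.smul {A B : Set V} {δ : ℝ} (h : Near δ A B) {c : ℝ} (hc : 0 ≤ c) :
    Near (c * δ) (c • A) (c • B) := by
  constructor
  · rintro _ ⟨a, ha, rfl⟩
    obtain ⟨b, hb, hab⟩ := h.1 a ha
    refine ⟨c • b, ⟨b, hb, rfl⟩, ?_⟩
    simp only [dist_smul₀, Real.norm_eq_abs, abs_of_nonneg hc]
    gcongr
  · rintro _ ⟨a, ha, rfl⟩
    obtain ⟨b, hb, hab⟩ := h.2 a ha
    refine ⟨c • b, ⟨b, hb, rfl⟩, ?_⟩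
    simp only [dist_smul₀, Real.norm_eq_abs, abs_of_nonneg hc]
    gcongr

theorem Near.mono {A B : Set V} {δ δ' : ℝ} (h : Near δ A B) (hδ : δ ≤ δ') : Near δ' A B :=
  ⟨fun a ha => (h.1 a ha).imp fun _ hb => ⟨hb.1, hb.2.trans hδ⟩,
    fun a ha => (h.2 a ha).imp fun _ hb => ⟨hb.1, hb.2.trans hδ⟩⟩

/-- A valuation obtained by composing with a Lipschitz operation on compact convex sets is
continuous. -/
theorem IsContVal.comp_of_near {ψ : Set V → ℝ} (h : IsContVal ψ) {F : Set W → Set V}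
    (hF : IsVal (fun A => ψ (F A))) (hcc : ∀ A, CC A → CC (F A))
    (hne : ∀ A : Set W, A.Nonempty → (F A).Nonempty) {M : ℝ} (hM : 0 < M)
    (hnear : ∀ A B δ, CC A → CC B → 0 < δ → Near δ A B → Near (M * δ) (F A) (F B)) :
    IsContVal (fun A => ψ (F A)) where
  toIsVal := hF
  cont A hA hAn ε hε := by
    obtain ⟨δ, hδ, H⟩ := h.cont (F A) (hcc A hA) (hne A hAn) ε hε
    refine ⟨δ / M, by positivity, fun B hB hBn hAB => H _ (hcc B hB) (hne B hBn) ?_⟩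
    have := hnear A B _ hA hB (by positivity) hAB
    rwa [mul_div_cancel₀ _ hM.ne'] at this

theorem IsContVal.comb {ψ χ : Set V → ℝ} (h : IsContVal ψ) (h' : IsContVal χ) (c : ℝ) :
    IsContVal (fun A => ψ A - c * χ A) where
  toIsVal := h.toIsVal.comb h'.toIsVal c
  cont A hA hAn ε hε := by
    obtain ⟨δ, hδ, H⟩ := h.cont A hA hAn (ε / 2) (by positivity)
    obtain ⟨δ', hδ', H'⟩ := h'.cont A hA hAn (ε / (2 * (|c| + 1))) (by positivity)
    refine ⟨min δ δ', lt_min hδ hδ', fun B hB hBn hAB => ?_⟩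
    have h1 := H B hB hBn (hAB.mono (min_le_left _ _))
    have h2 := H' B hB hBn (hAB.mono (min_le_right _ _))
    have h3 : |c| * |χ B - χ A| ≤ ε / 2 := by
      calc |c| * |χ B - χ A| ≤ (|c| + 1) * (ε / (2 * (|c| + 1))) := by
            gcongr
            linarith
        _ = ε / 2 := by field_simp
    calc |ψ B - c * χ B - (ψ A - c * χ A)| = |(ψ B - ψ A) - c * (χ B - χ A)| := by ring_nf
      _ ≤ |ψ B - ψ A| + |c * (χ B - χ A)| := abs_sub _ _
      _ < ε := by rw [abs_mul]; linarith

theorem IsContVal.comp_smul {ψ : Set V → ℝ} (h : IsContVal ψ) {c : ℝ} (hc : 0 < c) :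
    IsContVal (fun A => ψ (c • A)) :=
  h.comp_of_near (h.toIsVal.comp_smul hc.ne') (fun _ hA => hA.smul c)
    (fun _ hA => hA.smul_set) hc (fun _ _ _ _ _ _ hAB => hAB.smul hc.le)

theorem IsContVal.dbl {ψ : Set V → ℝ} (h : IsContVal ψ) : IsContVal (dbl ψ) :=
  (h.comp_smul two_pos).comb h 2

/-- A continuous valuation vanishing on a dense class of bodies vanishes. -/
theorem IsContVal.eq_zero_of_near {ψ : Set V → ℝ} (h : IsContVal ψ) {A : Set V} (hA : CC A)
    (hn : A.Nonempty)
    (H : ∀ δ > 0, ∃ B : Set V, CC B ∧ B.Nonempty ∧ Near δ A B ∧ ψ B = 0) : ψ A = 0 := by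
  by_contra hne
  obtain ⟨δ, hδ, H'⟩ := h.cont A hA hn _ (abs_pos.2 hne)
  obtain ⟨B, hB, hBn, hAB, h0⟩ := H δ hδ
  have := H' B hB hBn hAB
  rw [h0, zero_sub, abs_neg] at this
  exact lt_irrefl _ this

end basic

section refl

variable {V : Type*} [NormedAddCommGroup V] [InnerProductSpace ℝ V]

theorem refl_apply (v x : V) : refl v x = x - (2 * inner ℝ v x) • v := by
  simp [refl, smul_smul]

theorem refl_continuous (v : V) : Continuous (refl v) := by
  have : (refl v : V → V) = fun x => x - (2 * inner ℝ v x) • v := funext (refl_apply v)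
  rw [this]
  fun_prop

theorem refl_refl {v : V} (hv : ‖v‖ = 1) (x : V) : refl v (refl v x) = x := by
  simp only [refl_apply, inner_sub_right, inner_smul_right, real_inner_self_eq_norm_sq, hv]
  module

theorem image_refl_refl {v : V} (hv : ‖v‖ = 1) (A : Set V) : refl v '' (refl v '' A) = A := by
  rw [Set.image_image]
  simp [refl_refl hv]

theorem IsAnti.dbl {e : V} {ψ : Set V → ℝ} (h : IsAnti e ψ) : IsAnti e (dbl ψ) where
  toIsContVal := h.toIsContVal.dbl
  point := by simp [BodyVal.dbl, h.point]
  anti v hv hve A hA := by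
    simp only [BodyVal.dbl]
    rw [← image_smul_set (refl v) (2 : ℝ) A,
      h.anti v hv hve _ (hA.smul 2), h.anti v hv hve A hA]
    ring

theorem IsAnti.dbl_iterate {e : V} {ψ : Set V → ℝ} (h : IsAnti e ψ) (N : ℕ) :
    IsAnti e (BodyVal.dbl^[N] ψ) := by
  induction N with
  | zero => exact h
  | succ N ih => rw [Function.iterate_succ_apply']; exact ih.dbl

theorem IsAnti.singleton {e : V} {ψ : Set V → ℝ} (h : IsAnti e ψ) (x : V) : ψ {x} = 0 := by
  have := h.trans x {0} (CC.singleton 0)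
  rw [Set.vadd_set_singleton, vadd_eq_add, add_zero, h.point] at this
  exact this

end refl

end BodyVal

namespace BodyVal

section polynomiality

/-- Sequences given by the values of a real polynomial at the natural numbers. -/
def IsPolySeq (f : ℕ → ℝ) : Prop := ∃ P : Polynomial ℝ, ∀ k : ℕ, f k = P.eval (k : ℝ)

theorem IsPolySeq.add {f g : ℕ → ℝ} (hf : IsPolySeq f) (hg : IsPolySeq g) :
    IsPolySeq (fun k => f k + g k) := by
  obtain ⟨P, hP⟩ := hf
  obtain ⟨Q, hQ⟩ := hg
  exact ⟨P + Q, fun k => by simp [hP, hQ]⟩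

theorem IsPolySeq.sub {f g : ℕ → ℝ} (hf : IsPolySeq f) (hg : IsPolySeq g) :
    IsPolySeq (fun k => f k - g k) := by
  obtain ⟨P, hP⟩ := hf
  obtain ⟨Q, hQ⟩ := hg
  exact ⟨P - Q, fun k => by simp [hP, hQ]⟩

theorem IsPolySeq.const (c : ℝ) : IsPolySeq (fun _ => c) := ⟨Polynomial.C c, fun k => by simp⟩

theorem isPolySeq_sum_range_pow (d : ℕ) :
    IsPolySeq (fun k => ∑ i ∈ Finset.range k, (i : ℝ) ^ d) := by
  refine ⟨Polynomial.C ((d + 1 : ℝ)⁻¹) * (((Polynomial.bernoulli (d + 1)).map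
    (algebraMap ℚ ℝ)) - Polynomial.C ((bernoulli (d + 1) : ℚ) : ℝ)), fun k => ?_⟩
  have h := Polynomial.sum_range_pow_eq_bernoulli_sub k d
  have h' := congrArg (fun q : ℚ => (q : ℝ)) h
  push_cast at h'
  have h2 : ((Polynomial.bernoulli (d + 1)).map (algebraMap ℚ ℝ)).eval (k : ℝ)
      = ((Polynomial.eval (k : ℚ) (Polynomial.bernoulli (d + 1)) : ℚ) : ℝ) := by
    have := Polynomial.eval_map_algebraMap (B := ℝ) (Polynomial.bernoulli (d+1)) (k : ℝ)
    rw [this]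
    have h3 : (k : ℝ) = algebraMap ℚ ℝ (k : ℚ) := by simp
    rw [h3, Polynomial.aeval_algebraMap_apply]
    simp
  simp only [Polynomial.eval_mul, Polynomial.eval_C, Polynomial.eval_sub, h2]
  rw [← h']
  field_simp

theorem IsPolySeq.sum_range {f : ℕ → ℝ} (hf : IsPolySeq f) :
    IsPolySeq (fun k => ∑ i ∈ Finset.range k, f i) := by
  obtain ⟨P, hP⟩ := hf
  simp only [hP]
  clear hP
  induction P using Polynomial.induction_on' with
  | add p q hp hq =>
    have := hp.add hq
    simpa [Finset.sum_add_distrib] using this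
  | monomial d a =>
    obtain ⟨Q, hQ⟩ := isPolySeq_sum_range_pow d
    exact ⟨Polynomial.C a * Q, fun k => by simp [← hQ, Finset.mul_sum]⟩

theorem IsPolySeq.of_diff {f : ℕ → ℝ} (hf : IsPolySeq (fun k => f (k + 1) - f k)) :
    IsPolySeq f := by
  have := hf.sum_range.add (IsPolySeq.const (f 0))
  simp only [Finset.sum_range_sub f, sub_add_cancel] at this
  exact this

/-- The order simplex of size `k` in the last `m - p` coordinates. -/
def ordSimplex (m p : ℕ) (k : ℝ) : Set (Fin m → ℝ) :=
  {x | (∀ i, i.val < p → x i = 0) ∧ (∀ i, p ≤ i.val → 0 ≤ x i ∧ x i ≤ k) ∧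
    ∀ i j, p ≤ i.val → i ≤ j → x j ≤ x i}

/-- Intermediate pieces between `ordSimplex m p k` and `ordSimplex m p (k + 1)`. -/
def midSimplex (m p : ℕ) (k : ℝ) (j : ℕ) : Set (Fin m → ℝ) :=
  ordSimplex m p (k + 1) ∩ {x | ∀ i : Fin m, j ≤ i.val → x i ≤ k}

/-- The unit order simplex in the coordinates `p, …, j`. -/
def preSimplex (m p j : ℕ) : Set (Fin m → ℝ) :=
  ordSimplex m p 1 ∩ {x | ∀ i : Fin m, j < i.val → x i = 0}

/-- The facet of `preSimplex m p j` where the last coordinate vanishes. -/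
def preFacet (m p j : ℕ) : Set (Fin m → ℝ) :=
  ordSimplex m p 1 ∩ {x | ∀ i : Fin m, j ≤ i.val → x i = 0}

theorem CC.ordSimplex (m p : ℕ) (k : ℝ) : CC (ordSimplex m p k) := by
  constructor
  · have hsub : BodyVal.ordSimplex m p k ⊆ Set.Icc (fun _ => min 0 k) (fun _ => max 0 k) := by
      rintro x ⟨h1, h2, h3⟩
      constructor <;> intro i <;> by_cases hi : i.val < p
      · simp [h1 i hi]
      · exact (min_le_left _ _).trans (h2 i (not_lt.1 hi)).1
      · simp [h1 i hi]
      · exact (h2 i (not_lt.1 hi)).2.trans (le_max_right _ _)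
    refine isCompact_Icc.of_isClosed_subset ?_ hsub
    have : BodyVal.ordSimplex m p k = {x | ∀ i : Fin m, i.val < p → x i = 0} ∩
      ({x | ∀ i : Fin m, p ≤ i.val → 0 ≤ x i ∧ x i ≤ k} ∩
      {x | ∀ i j : Fin m, p ≤ i.val → i ≤ j → x j ≤ x i}) := by
      ext x; rfl
    rw [this]
    refine IsClosed.inter ?_ (IsClosed.inter ?_ ?_)
    · simp only [Set.ofPred_forall]
      exact isClosed_iInter fun i => isClosed_iInter fun _ =>
        isClosed_eq (continuous_apply i) continuous_const
    · simp only [Set.ofPred_forall, Set.ofPred_and]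
      exact isClosed_iInter fun i => isClosed_iInter fun _ =>
        (isClosed_le continuous_const (continuous_apply i)).inter
          (isClosed_le (continuous_apply i) continuous_const)
    · simp only [Set.ofPred_forall]
      exact isClosed_iInter fun i => isClosed_iInter fun j => isClosed_iInter fun _ =>
        isClosed_iInter fun _ => isClosed_le (continuous_apply j) (continuous_apply i)
  · rintro x ⟨h1, h2, h3⟩ y ⟨g1, g2, g3⟩ a b ha hb hab
    refine ⟨fun i hi => by simp [h1 i hi, g1 i hi], fun i hi => ⟨?_, ?_⟩, fun i j hi hij => ?_⟩
    · have := (h2 i hi).1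
      have := (g2 i hi).1
      simp only [Pi.add_apply, Pi.smul_apply, smul_eq_mul]
      positivity
    · have u1 := mul_le_mul_of_nonneg_left (h2 i hi).2 ha
      have u2 := mul_le_mul_of_nonneg_left (g2 i hi).2 hb
      have : k = a * k + b * k := by rw [← add_mul, hab, one_mul]
      simp only [Pi.add_apply, Pi.smul_apply, smul_eq_mul]
      linarith
    · have u1 := mul_le_mul_of_nonneg_left (h3 i j hi hij) ha
      have u2 := mul_le_mul_of_nonneg_left (g3 i j hi hij) hb
      simp only [Pi.add_apply, Pi.smul_apply, smul_eq_mul]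
      linarith

theorem convex_coord_le {m : ℕ} (k : ℝ) (s : Fin m → Prop) :
    Convex ℝ {x : Fin m → ℝ | ∀ i, s i → x i ≤ k} := by
  simp only [Set.ofPred_forall]
  exact convex_iInter fun i => convex_iInter fun _ =>
    convex_halfSpace_le (LinearMap.proj (R := ℝ) (φ := fun _ : Fin m => ℝ) i).isLinear k

theorem isClosed_coord_le {m : ℕ} (k : ℝ) (s : Fin m → Prop) :
    IsClosed {x : Fin m → ℝ | ∀ i, s i → x i ≤ k} := by
  simp only [Set.ofPred_forall]
  exact isClosed_iInter fun i => isClosed_iInter fun _ =>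
    isClosed_le (continuous_apply i) continuous_const

theorem CC.midSimplex (m p : ℕ) (k : ℝ) (j : ℕ) : CC (midSimplex m p k j) :=
  (CC.ordSimplex m p (k + 1)).inter_closed (isClosed_coord_le k _) (convex_coord_le k _)

theorem CC.coordZero {m : ℕ} {A : Set (Fin m → ℝ)} (hA : CC A) (s : Fin m → Prop) :
    CC (A ∩ {x | ∀ i, s i → x i = 0}) := by
  refine hA.inter_closed ?_ ?_
  · simp only [Set.ofPred_forall]
    exact isClosed_iInter fun i => isClosed_iInter fun _ =>
      isClosed_eq (continuous_apply i) continuous_const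
  · simp only [Set.ofPred_forall]
    exact convex_iInter fun i => convex_iInter fun _ =>
      convex_hyperplane (LinearMap.proj (R := ℝ) (φ := fun _ : Fin m => ℝ) i).isLinear 0

theorem CC.preSimplex (m p j : ℕ) : CC (preSimplex m p j) := (CC.ordSimplex m p 1).coordZero _

theorem CC.preFacet (m p j : ℕ) : CC (preFacet m p j) := (CC.ordSimplex m p 1).coordZero _

/-- The vector with entries `k` in the coordinates `p, …, j`. -/
def blockVec (m p j : ℕ) (k : ℝ) : Fin m → ℝ := fun i => if p ≤ i.val ∧ i.val ≤ j then k else 0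

theorem midSimplex_inter_ge {m p : ℕ} (k : ℕ) (j : Fin m) (hj : p ≤ j.val) :
    midSimplex m p k (j + 1) ∩ {x | (k : ℝ) ≤ x j} =
      blockVec m p j k +ᵥ (preSimplex m p j + ordSimplex m (j + 1) k) := by
  have hk : (0 : ℝ) ≤ k := Nat.cast_nonneg k
  ext x
  simp only [Set.mem_vadd_set, Set.mem_add, vadd_eq_add]
  constructor
  · rintro ⟨⟨⟨h1, h2, h3⟩, h4⟩, h5⟩
    have h4' : ∀ i : Fin m, j.val + 1 ≤ i.val → x i ≤ k := h4
    have h5' : (k : ℝ) ≤ x j := h5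
    refine ⟨x - blockVec m p j k, ⟨fun i => if i.val ≤ j.val then x i - blockVec m p j k i else 0,
      ⟨⟨?_, ?_, ?_⟩, ?_⟩, fun i => if i.val ≤ j.val then 0 else x i, ⟨?_, ?_, ?_⟩, ?_⟩, ?_⟩
    · intro i hi
      simp [blockVec, h1 i hi, hi]
    · intro i hi
      by_cases hij : i.val ≤ j.val
      · have := h3 i j hi hij
        have := (h2 i hi).2
        simp only [hij, blockVec, hi, and_self, if_true]
        constructor <;> linarith
      · simp [hij]
    · intro i i' hi hii'
      have hii'' : i.val ≤ i'.val := hii'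
      by_cases h : i'.val ≤ j.val
      · have := h3 i i' hi hii'
        simp [h, hii''.trans h, blockVec, hi, hi.trans hii'', this]
      · by_cases h' : i.val ≤ j.val
        · have := h3 i j hi h'
          simp only [h, h', blockVec, hi, and_self, if_true, if_false]
          linarith
        · simp [h, h']
    · intro i hi
      simp [not_le.2 hi]
    · intro i hi
      simp [Nat.lt_succ_iff.1 hi]
    · intro i hi
      have h : ¬ i.val ≤ j.val := by omega
      simp only [h, if_false]
      exact ⟨(h2 i (by omega)).1, h4' i hi⟩
    · intro i i' hi hii'
      have hii'' : i.val ≤ i'.val := hii'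
      have h : ¬ i.val ≤ j.val := by omega
      have h' : ¬ i'.val ≤ j.val := by omega
      simp only [h, h', if_false]
      exact h3 i i' (by omega) hii'
    · funext i
      have h : ∀ a b : ℝ, (if i.val ≤ j.val then a - b else 0) + (if i.val ≤ j.val then 0 else a)
          = a - (if i.val ≤ j.val then b else 0) := fun a b => by split_ifs <;> ring
      simp only [Pi.add_apply, Pi.sub_apply, h]
      by_cases h : i.val ≤ j.val
      · simp only [h, if_true]
      · simp only [h, blockVec, if_false, and_false]
    · simp
  · rintro ⟨_, ⟨y, ⟨⟨h1, h2, h3⟩, h4⟩, z, ⟨g1, g2, g3⟩, rfl⟩, rfl⟩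
    have h4' : ∀ i : Fin m, j.val < i.val → y i = 0 := h4
    refine ⟨⟨⟨?_, ?_, ?_⟩, ?_⟩, ?_⟩
    · intro i hi
      simp [blockVec, h1 i hi, not_le.2 hi, g1 i (by omega)]
    · intro i hi
      simp only [Pi.add_apply, blockVec, hi, true_and]
      by_cases hij : i.val ≤ j.val
      · have := h2 i hi
        simp only [hij, if_true, g1 i (by omega)]
        constructor <;> linarith
      · have := g2 i (by omega)
        simp only [hij, if_false, h4' i (by omega)]
        constructor <;> linarith
    · intro i i' hi hii'
      have hii'' : i.val ≤ i'.val := hii'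
      simp only [Pi.add_apply, blockVec, hi, hi.trans hii'', true_and]
      by_cases h : i'.val ≤ j.val
      · have := h3 i i' hi hii'
        simp only [h, hii''.trans h, if_true, g1 i (by omega), g1 i' (by omega)]
        linarith
      · by_cases h' : i.val ≤ j.val
        · have := (h2 i hi).1
          have := (g2 i' (by omega)).2
          simp only [h, h', if_true, if_false, g1 i (by omega), h4' i' (by omega)]
          linarith
        · have := g3 i i' (by omega) hii'
          simp only [h, h', if_false, h4' i (by omega), h4' i' (by omega)]
          linarith
    · intro i hi
      have := (g2 i hi).2
      have h : ¬ i.val ≤ j.val := by omega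
      simp only [Pi.add_apply, blockVec, h, and_false, if_false, h4' i (by omega)]
      linarith
    · have := (h2 j hj).1
      have h0 := g1 j (by omega)
      simp only [Set.mem_ofPred_eq, Pi.add_apply, blockVec, hj, le_refl, and_self, if_true, h0]
      linarith

theorem midSimplex_inter_eq {m p : ℕ} (k : ℕ) (j : Fin m) (hj : p ≤ j.val) :
    midSimplex m p k j ∩ {x | (k : ℝ) ≤ x j} =
      blockVec m p j k +ᵥ (preFacet m p j + ordSimplex m (j + 1) k) := by
  have e1 : midSimplex m p k j ∩ {x | (k : ℝ) ≤ x j} =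
      (midSimplex m p k (j + 1) ∩ {x | (k : ℝ) ≤ x j}) ∩ {x | x j = k} := by
    ext x
    constructor
    · rintro ⟨⟨h1, h2⟩, h3⟩
      exact ⟨⟨⟨h1, fun i hi => h2 i (by omega)⟩, h3⟩, le_antisymm (h2 j le_rfl) h3⟩
    · rintro ⟨⟨⟨h1, h2⟩, h3⟩, h4⟩
      refine ⟨⟨h1, fun i hi => ?_⟩, h3⟩
      rcases Nat.eq_or_lt_of_le hi with h | h
      · rw [show i = j from Fin.ext h.symm]
        exact le_of_eq h4
      · exact h2 i h
  rw [e1, midSimplex_inter_ge k j hj]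
  ext x
  constructor
  · rintro ⟨⟨_, ⟨y, ⟨h1, h2⟩, z, hz, rfl⟩, rfl⟩, hx⟩
    refine ⟨_, ⟨y, ⟨h1, fun i hi => ?_⟩, z, hz, rfl⟩, rfl⟩
    rcases Nat.eq_or_lt_of_le hi with h | h
    · rw [show i = j from Fin.ext h.symm]
      have h0 := hz.1 j (by omega)
      simpa [blockVec, hj, h0] using hx
    · exact h2 i h
  · rintro ⟨_, ⟨y, ⟨h1, h2⟩, z, hz, rfl⟩, rfl⟩
    refine ⟨⟨_, ⟨y, ⟨h1, fun i hi => h2 i (le_of_lt hi)⟩, z, hz, rfl⟩, rfl⟩, ?_⟩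
    have h0 := hz.1 j (by omega)
    have := h2 j le_rfl
    simp [blockVec, hj, h0, this]

theorem IsVal.isPolySeq_ordSimplex {m : ℕ} (d : ℕ) : ∀ (p : ℕ), p + d = m →
    ∀ {χ : Set (Fin m → ℝ) → ℝ}, IsVal χ → IsPolySeq (fun k => χ (ordSimplex m p k)) := by
  induction d using Nat.strong_induction_on with
  | _ d ih =>
  intro p hp χ h
  rcases Nat.eq_zero_or_pos d with rfl | hd
  · have : ∀ k : ℕ, ordSimplex m p k = {0} := by
      intro k
      ext x
      simp only [Set.mem_singleton_iff]
      constructor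
      · intro hx
        funext i
        exact hx.1 i (by have := i.2; omega)
      · rintro rfl
        exact ⟨fun _ _ => rfl, fun i _ => ⟨le_rfl, Nat.cast_nonneg k⟩, fun _ _ _ _ => le_rfl⟩
    simp only [this]
    exact IsPolySeq.const _
  apply IsPolySeq.of_diff
  have key : ∀ q, p ≤ q → q ≤ m →
      IsPolySeq (fun k => χ (midSimplex m p k q) - χ (midSimplex m p k p)) := by
    intro q hpq
    induction q, hpq using Nat.le_induction with
    | base => intro _; simpa using IsPolySeq.const 0
    | succ q hpq ihq =>
      intro hqm
      let j : Fin m := ⟨q, hqm⟩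
      have hstep : ∀ k : ℕ, χ (midSimplex m p k (q + 1)) - χ (midSimplex m p k q) =
          χ (preSimplex m p q + ordSimplex m (q + 1) k)
          - χ (preFacet m p q + ordSimplex m (q + 1) k) := by
        intro k
        have hYc : CC (midSimplex m p k (q + 1) ∩ {x | (k : ℝ) ≤ x j}) :=
          (CC.midSimplex m p k (q + 1)).inter_closed
            (isClosed_le continuous_const (continuous_apply j))
            (convex_halfSpace_ge
              (LinearMap.proj (R := ℝ) (φ := fun _ : Fin m => ℝ) j).isLinear _)
        have hU : midSimplex m p k q ∪ (midSimplex m p k (q + 1) ∩ {x | (k : ℝ) ≤ x j})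
            = midSimplex m p k (q + 1) := by
          ext x
          constructor
          · rintro (⟨h1, h2⟩ | h1)
            · exact ⟨h1, fun i hi => h2 i (by omega)⟩
            · exact h1.1
          · intro hx
            rcases le_total (k : ℝ) (x j) with hk | hk
            · exact Or.inr ⟨hx, hk⟩
            · refine Or.inl ⟨hx.1, fun i hi => ?_⟩
              exact (hx.1.2.2 j i hpq hi).trans hk
        have hI : midSimplex m p k q ∩ (midSimplex m p k (q + 1) ∩ {x | (k : ℝ) ≤ x j})
            = midSimplex m p k q ∩ {x | (k : ℝ) ≤ x j} := by
          ext x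
          constructor
          · rintro ⟨h1, _, h2⟩
            exact ⟨h1, h2⟩
          · rintro ⟨h1, h2⟩
            exact ⟨h1, ⟨h1.1, fun i hi => h1.2 i (by omega)⟩, h2⟩
        have := h.add _ _ (CC.midSimplex m p k q) hYc (by rw [hU]; exact (CC.midSimplex _ _ _ _).2)
        rw [hU, hI, midSimplex_inter_eq k j hpq, midSimplex_inter_ge k j hpq,
          h.trans _ _ ((CC.preFacet _ _ _).add (CC.ordSimplex _ _ _)),
          h.trans _ _ ((CC.preSimplex _ _ _).add (CC.ordSimplex _ _ _))] at this
        linarith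
      have h1 := ih (m - (q + 1)) (by omega) (q + 1) (by omega) (h.add_left (CC.preSimplex m p q))
      have h2 := ih (m - (q + 1)) (by omega) (q + 1) (by omega) (h.add_left (CC.preFacet m p q))
      have h3 := (h1.sub h2).add (ihq (by omega))
      obtain ⟨P, hP⟩ := h3
      refine ⟨P, fun k => ?_⟩
      have := hP k
      simp only at this ⊢
      rw [← this, ← hstep]
      ring
  have := key m (by omega) le_rfl
  convert this using 3 with k
  · congr 1
    ext x
    constructor
    · intro hx
      refine ⟨by simpa using hx, fun i hi => absurd i.2 (not_lt.2 hi)⟩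
    · intro hx
      simpa using hx.1
  · congr 1
    ext x
    constructor
    · rintro ⟨h1, h2, h3⟩
      exact ⟨⟨h1, fun i hi => ⟨(h2 i hi).1, (h2 i hi).2.trans (by linarith)⟩, h3⟩,
        fun i hi => (h2 i hi).2⟩
    · rintro ⟨⟨h1, h2, h3⟩, h4⟩
      exact ⟨h1, fun i hi => ⟨(h2 i hi).1, h4 i hi⟩, h3⟩

end polynomiality

end BodyVal

namespace BodyVal

section limits

variable {V : Type*} [NormedAddCommGroup V] [NormedSpace ℝ V]

theorem mem_of_near {M : Set V} (hM : IsClosed M) {x : V}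
    (h : ∀ δ > 0, ∃ z ∈ M, dist x z ≤ δ) : x ∈ M := by
  rw [← hM.closure_eq, Metric.mem_closure_iff]
  intro ε hε
  obtain ⟨z, hz, hxz⟩ := h (ε / 2) (by positivity)
  exact ⟨z, hz, by linarith⟩

/-- Blaschke selection. -/
theorem exists_near_limit {K : Set V} (hK : IsCompact K) (X : ℕ → Set V) (hX : ∀ n, CC (X n))
    (hne : ∀ n, (X n).Nonempty) (hs : ∀ n, X n ⊆ K) :
    ∃ M : Set V, CC M ∧ M.Nonempty ∧ ∀ δ > 0, ∀ N : ℕ, ∃ n ≥ N, Near δ M (X n) := by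
  let Y : ℕ → TopologicalSpace.NonemptyCompacts V := fun n => ⟨⟨X n, (hX n).1⟩, hne n⟩
  obtain ⟨M, -, φ, hφ, hlim⟩ :=
    (TopologicalSpace.NonemptyCompacts.isCompact_subsets_of_isCompact hK).tendsto_subseq
      (x := Y) hs
  have hnear : ∀ δ > 0, ∀ N : ℕ, ∃ n ≥ N, Near δ (M : Set V) (X n) := by
    intro δ hδ N
    obtain ⟨n₀, hn₀⟩ := Metric.tendsto_atTop.1 hlim δ hδ
    have hn := hn₀ (max n₀ N) (le_max_left _ _)
    rw [Metric.NonemptyCompacts.dist_eq, Metric.hausdorffDist_comm] at hn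
    have fin : Metric.hausdorffEDist (M : Set V) (X (φ (max n₀ N))) ≠ ⊤ :=
      Metric.hausdorffEDist_ne_top_of_nonempty_of_bounded M.nonempty (hne _) M.isCompact.isBounded
        (hX _).1.isBounded
    refine ⟨φ (max n₀ N), (le_max_right _ _).trans hφ.le_apply, fun a ha => ?_, fun b hb => ?_⟩
    · obtain ⟨b, hb, hab⟩ := Metric.exists_dist_lt_of_hausdorffDist_lt ha hn fin
      exact ⟨b, hb, hab.le⟩
    · obtain ⟨a, ha, hab⟩ := Metric.exists_dist_lt_of_hausdorffDist_lt' hb hn fin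
      exact ⟨a, ha, hab.le⟩
  refine ⟨M, ⟨M.isCompact, ?_⟩, M.nonempty, hnear⟩
  intro x hx y hy a b ha hb hab
  refine mem_of_near M.isCompact.isClosed fun δ hδ => ?_
  obtain ⟨n, -, h1, h2⟩ := hnear (δ / 2) (by positivity) 0
  obtain ⟨x', hx', hxx⟩ := h1 x hx
  obtain ⟨y', hy', hyy⟩ := h1 y hy
  obtain ⟨z, hz, hzz⟩ := h2 _ ((hX n).2 hx' hy' ha hb hab)
  refine ⟨z, hz, ?_⟩
  have h3 : dist (a • x + b • y) (a • x' + b • y') ≤ δ / 2 := by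
    calc dist (a • x + b • y) (a • x' + b • y') ≤ dist (a • x) (a • x') + dist (b • y) (b • y') :=
          dist_add_add_le _ _ _ _
      _ = a * dist x x' + b * dist y y' := by
          simp [dist_smul₀, abs_of_nonneg ha, abs_of_nonneg hb]
      _ ≤ a * (δ / 2) + b * (δ / 2) := by gcongr
      _ = δ / 2 := by rw [← add_mul, hab, one_mul]
  calc dist (a • x + b • y) z ≤ dist (a • x + b • y) (a • x' + b • y')
        + dist (a • x' + b • y') z := dist_triangle _ _ _
    _ ≤ δ := by rw [dist_comm _ z]; linarith

theorem IsContVal.tendsto {ψ : Set V → ℝ} (h : IsContVal ψ) {A : Set V} (hA : CC A)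
    (hn : A.Nonempty) {X : ℕ → Set V} (hX : ∀ n, CC (X n)) (hne : ∀ n, (X n).Nonempty)
    {δ : ℕ → ℝ} (hδ : Filter.Tendsto δ Filter.atTop (nhds 0)) (hnear : ∀ n, Near (δ n) A (X n)) :
    Filter.Tendsto (fun n => ψ (X n)) Filter.atTop (nhds (ψ A)) := by
  rw [Metric.tendsto_atTop]
  intro ε hε
  obtain ⟨d, hd, H⟩ := h.cont A hA hn ε hε
  obtain ⟨N, hN⟩ := Filter.eventually_atTop.1 (hδ.eventually (gt_mem_nhds hd))
  exact ⟨N, fun n hn' => by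
    rw [Real.dist_eq]
    exact H _ (hX n) (hne n) ((hnear n).mono (hN n hn').le)⟩

end limits

section additivity

variable {V : Type*} [NormedAddCommGroup V] [NormedSpace ℝ V]

theorem ordSimplex_nonempty (m p : ℕ) {k : ℝ} (hk : 0 ≤ k) : (ordSimplex m p k).Nonempty :=
  ⟨0, fun _ _ => rfl, fun _ _ => ⟨le_rfl, hk⟩, fun _ _ _ _ => le_rfl⟩

theorem smul_ordSimplex (m p : ℕ) {k : ℝ} (hk : 0 ≤ k) :
    k • ordSimplex m p 1 = ordSimplex m p k := by
  rcases hk.eq_or_lt with rfl | hk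
  · rw [Set.zero_smul_set (ordSimplex_nonempty m p zero_le_one)]
    ext x
    constructor
    · intro hx
      rw [Set.mem_zero.1 hx]
      exact ⟨fun _ _ => rfl, fun _ _ => ⟨le_rfl, le_rfl⟩, fun _ _ _ _ => le_rfl⟩
    · rintro ⟨h1, h2, -⟩
      refine Set.mem_zero.2 (funext fun i => ?_)
      by_cases hi : i.val < p
      · exact h1 i hi
      · exact le_antisymm (h2 i (not_lt.1 hi)).2 (h2 i (not_lt.1 hi)).1
  · ext x
    rw [Set.mem_smul_set_iff_inv_smul_mem₀ hk.ne']
    refine and_congr (forall₂_congr fun i _ => ?_) (and_congr (forall₂_congr fun i _ => ?_)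
      (forall₄_congr fun i j _ _ => ?_))
    · simp [hk.ne']
    · simp only [Pi.smul_apply, smul_eq_mul]
      refine and_congr ?_ ?_
      · rw [mul_nonneg_iff_of_pos_left (inv_pos.2 hk)]
      · rw [inv_mul_le_iff₀ hk, mul_one]
    · simp only [Pi.smul_apply, smul_eq_mul]
      exact mul_le_mul_iff_right₀ (inv_pos.2 hk)

theorem IsPolySeq.affine_of_tendsto {f : ℕ → ℝ} (hf : IsPolySeq f) {c : ℝ}
    (h : Filter.Tendsto (fun j : ℕ => f (2 ^ j) / 2 ^ j) Filter.atTop (nhds c)) (k : ℕ) :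
    f k = f 0 + k * c := by
  obtain ⟨P, hP⟩ := hf
  have hpow : Filter.Tendsto (fun j : ℕ => (2 : ℝ) ^ j) Filter.atTop Filter.atTop :=
    tendsto_pow_atTop_atTop_of_one_lt one_lt_two
  have hdeg : P.degree ≤ 1 := by
    by_contra hd
    push Not at hd
    have h1 := (Polynomial.abs_div_tendsto_atTop_atTop_of_degree_gt P Polynomial.X
      (by simpa using hd) Polynomial.X_ne_zero).comp hpow
    have h2 := h.abs
    refine not_tendsto_nhds_of_tendsto_atTop h1 _ (h2.congr fun j => ?_)
    simp [hP]
  obtain ⟨b, a, hab⟩ : ∃ b a, P = Polynomial.C b * Polynomial.X + Polynomial.C a :=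
    ⟨_, _, Polynomial.eq_X_add_C_of_degree_le_one hdeg⟩
  have hbc : b = c := by
    refine tendsto_nhds_unique ?_ h
    have h3 : Filter.Tendsto (fun j : ℕ => b + a * ((2 : ℝ) ^ j)⁻¹) Filter.atTop
        (nhds (b + a * 0)) :=
      tendsto_const_nhds.add (tendsto_const_nhds.mul (tendsto_inv_atTop_zero.comp hpow))
    rw [mul_zero, add_zero] at h3
    refine h3.congr fun j => ?_
    rw [hP, hab]
    simp
    field_simp
  rw [hP, hP, hab, hbc]
  simp
  ring

theorem smul_pow_of_dbl {ψ : Set V → ℝ} (hd : ∀ A, CC A → dbl ψ A = 0) {A : Set V} (hA : CC A)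
    (j : ℕ) : ψ ((2 : ℝ) ^ j • A) = 2 ^ j * ψ A := by
  induction j with
  | zero => simp
  | succ j ih =>
    have := hd _ (hA.smul (2 ^ j))
    rw [dbl, ih, smul_smul] at this
    rw [pow_succ', mul_assoc]
    linarith

theorem add_simplex_of_dbl {ψ : Set V → ℝ} (h : IsContVal ψ) (hd : ∀ A, CC A → dbl ψ A = 0)
    {m : ℕ} (f : (Fin m → ℝ) →ₗ[ℝ] V) (hf : Function.Injective f) {L : Set V} (hL : CC L)
    (hLn : L.Nonempty) :
    ψ (L + f '' ordSimplex m 0 1) = ψ L + ψ (f '' ordSimplex m 0 1) := by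
  have hc : Continuous f := f.continuous_of_finiteDimensional
  set D := f '' ordSimplex m 0 1 with hD
  have hDc : CC D := (CC.ordSimplex m 0 1).image f hc
  have hDn : D.Nonempty := (ordSimplex_nonempty m 0 zero_le_one).image f
  have hk : ∀ k : ℕ, f '' ordSimplex m 0 k = (k : ℝ) • D := by
    intro k
    rw [hD, ← smul_ordSimplex m 0 (Nat.cast_nonneg k), image_smul_set]
  have hpoly := ((h.toIsVal.add_left hL).comp_image f hf hc).isPolySeq_ordSimplex m 0 (by simp)
  simp only [hk] at hpoly
  have hlim : Filter.Tendsto (fun j : ℕ => ψ (L + ((2 ^ j : ℕ) : ℝ) • D) / 2 ^ j) Filter.atTop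
      (nhds (ψ D)) := by
    obtain ⟨R, hR⟩ := hL.1.isBounded.exists_norm_le
    have hcc : ∀ j : ℕ, CC (((2 : ℝ) ^ j)⁻¹ • L + D) := fun j => (hL.smul _).add hDc
    have hδ : Filter.Tendsto (fun j : ℕ => ((2 : ℝ) ^ j)⁻¹ * R) Filter.atTop (nhds 0) := by
      have := (tendsto_inv_atTop_zero.comp
        (tendsto_pow_atTop_atTop_of_one_lt (one_lt_two (α := ℝ)))).mul_const R
      simpa using this
    refine (h.tendsto hDc hDn hcc (fun j => (hLn.smul_set).add hDn) hδ ?_).congr ?_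
    · have hb : ∀ j : ℕ, ∀ l ∈ L, ∀ d : V, dist d (((2 : ℝ) ^ j)⁻¹ • l + d) ≤
          ((2 : ℝ) ^ j)⁻¹ * R := by
        intro j l hl d
        rw [dist_eq_norm, show d - (((2 : ℝ) ^ j)⁻¹ • l + d) = - (((2 : ℝ) ^ j)⁻¹ • l) by abel,
          norm_neg, norm_smul, Real.norm_of_nonneg (by positivity)]
        gcongr
        exact hR l hl
      intro j
      constructor
      · intro d hd'
        obtain ⟨l, hl⟩ := hLn
        exact ⟨_, ⟨_, ⟨l, hl, rfl⟩, d, hd', rfl⟩, hb j l hl d⟩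
      · rintro _ ⟨_, ⟨l, hl, rfl⟩, d, hd', rfl⟩
        exact ⟨d, hd', hb j l hl d⟩
    · intro j
      have h2 : ((2 ^ j : ℕ) : ℝ) = 2 ^ j := by push_cast; rfl
      have h3 : L + ((2 ^ j : ℕ) : ℝ) • D = (2 : ℝ) ^ j • (((2 : ℝ) ^ j)⁻¹ • L + D) := by
        rw [smul_add, smul_smul, mul_inv_cancel₀ (by positivity), one_smul, h2]
      rw [h3, smul_pow_of_dbl hd (hcc j)]
      field_simp
  have h1 := hpoly.affine_of_tendsto hlim 1
  simp only [Nat.cast_one, one_smul, Nat.cast_zero, Set.zero_smul_set hDn, add_zero,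
    one_mul] at h1
  exact h1

end additivity

end BodyVal

namespace BodyVal

section averaging

variable {V : Type*} [NormedAddCommGroup V] [InnerProductSpace ℝ V]

/-- The rotation by `t` in the plane spanned by the orthonormal vectors `v`, `w`. -/
def planeRot (v w : V) (t : ℝ) : V →ₗ[ℝ] V :=
  refl (Real.cos (t / 2) • v + Real.sin (t / 2) • w) ∘ₗ refl v

theorem planeRot_apply {v w : V} (hv : ‖v‖ = 1) (hvw : inner ℝ v w = 0)
    (t : ℝ) (x : V) : planeRot v w t x = x +
      ((Real.cos t - 1) * inner ℝ v x - Real.sin t * inner ℝ w x) • v +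
      (Real.sin t * inner ℝ v x + (Real.cos t - 1) * inner ℝ w x) • w := by
  have h1 : Real.cos t = 2 * Real.cos (t / 2) ^ 2 - 1 := by
    rw [← Real.cos_two_mul]; ring_nf
  have h2 : Real.sin t = 2 * Real.sin (t / 2) * Real.cos (t / 2) := by
    rw [← Real.sin_two_mul]; ring_nf
  have h3 := Real.sin_sq_add_cos_sq (t / 2)
  have hwv : inner ℝ w v = 0 := by rw [real_inner_comm]; exact hvw
  have h4 : Real.sin (t / 2) ^ 2 = 1 - Real.cos (t / 2) ^ 2 := by linarith
  simp only [planeRot, LinearMap.comp_apply, refl_apply, inner_add_left, inner_sub_right,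
    inner_smul_left, inner_smul_right, real_inner_self_eq_norm_sq, hv, hwv,
    RCLike.conj_to_real]
  generalize inner ℝ v x = a
  generalize inner ℝ w x = b
  rw [h1, h2]
  generalize Real.cos (t / 2) = c at *
  generalize Real.sin (t / 2) = s at *
  rw [sub_eq_add_neg, add_assoc x, sub_eq_add_neg, add_assoc x]
  congr 1
  match_scalars
  · ring
  · ring_nf
    rw [h4]
    ring

theorem planeRot_norm_unit {v w : V} (hv : ‖v‖ = 1) (hw : ‖w‖ = 1) (hvw : inner ℝ v w = 0)
    (t : ℝ) : ‖Real.cos t • v + Real.sin t • w‖ = 1 := by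
  have h : ‖Real.cos t • v + Real.sin t • w‖ ^ 2 = 1 := by
    rw [@norm_add_sq_real, norm_smul, norm_smul, inner_smul_left, inner_smul_right, hvw, hv, hw]
    simp
  nlinarith [norm_nonneg (Real.cos t • v + Real.sin t • w)]

theorem norm_refl {v : V} (hv : ‖v‖ = 1) (x : V) : ‖refl v x‖ = ‖x‖ := by
  have h : ‖refl v x‖ ^ 2 = ‖x‖ ^ 2 := by
    rw [refl_apply, @norm_sub_sq_real, norm_smul, inner_smul_right, hv, real_inner_comm v x]
    simp [mul_pow, sq_abs]
    ring
  exact (sq_eq_sq₀ (norm_nonneg _) (norm_nonneg _)).1 h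

theorem norm_planeRot {v w : V} (hv : ‖v‖ = 1) (hw : ‖w‖ = 1) (hvw : inner ℝ v w = 0)
    (t : ℝ) (x : V) : ‖planeRot v w t x‖ = ‖x‖ := by
  rw [planeRot, LinearMap.comp_apply, norm_refl (planeRot_norm_unit hv hw hvw _), norm_refl hv]

theorem planeRot_injective {v w : V} (hv : ‖v‖ = 1) (hw : ‖w‖ = 1) (hvw : inner ℝ v w = 0)
    (t : ℝ) : Function.Injective (planeRot v w t) := by
  rw [injective_iff_map_eq_zero]
  intro x hx
  rw [← norm_eq_zero, ← norm_planeRot hv hw hvw t, hx, norm_zero]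

theorem planeRot_add {v w : V} (hv : ‖v‖ = 1) (hw : ‖w‖ = 1) (hvw : inner ℝ v w = 0)
    (s t : ℝ) (x : V) : planeRot v w s (planeRot v w t x) = planeRot v w (s + t) x := by
  have hwv : inner ℝ w v = 0 := by rw [real_inner_comm]; exact hvw
  simp only [planeRot_apply hv hvw, inner_add_right, inner_smul_right,
    real_inner_self_eq_norm_sq, hv, hw, hwv, hvw, Real.cos_add, Real.sin_add]
  module

theorem planeRot_two_pi {v w : V} (hv : ‖v‖ = 1) (hvw : inner ℝ v w = 0) (x : V) :
    planeRot v w (2 * Real.pi) x = x := by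
  simp [planeRot_apply hv hvw]

theorem continuous_planeRot (v w : V) (t : ℝ) : Continuous (planeRot v w t) := by
  exact (refl_continuous _).comp (refl_continuous _)

theorem refl_eq_planeRot {v w : V} (hv : ‖v‖ = 1) (hvw : inner ℝ v w = 0) (x : V) :
    ∃ t : ℝ, 0 ≤ t ∧ t < 2 * Real.pi ∧ refl v x = planeRot v w t x := by
  set z : ℂ := ⟨inner ℝ v x, inner ℝ w x⟩ with hz
  have hre : ‖z‖ * Real.cos z.arg = inner ℝ v x := Complex.norm_mul_cos_arg z
  have him : ‖z‖ * Real.sin z.arg = inner ℝ w x := Complex.norm_mul_sin_arg z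
  set t := Real.pi - 2 * z.arg with ht
  refine ⟨toIcoMod Real.two_pi_pos 0 t, (toIcoMod_mem_Ico' Real.two_pi_pos t).1,
    (toIcoMod_mem_Ico' Real.two_pi_pos t).2, ?_⟩
  have hm : toIcoMod Real.two_pi_pos 0 t = t - (toIcoDiv Real.two_pi_pos 0 t) * (2 * Real.pi) := by
    rw [toIcoMod, zsmul_eq_mul]
  have hs := Real.sin_sq_add_cos_sq z.arg
  have hcos : Real.cos t = Real.sin z.arg ^ 2 - Real.cos z.arg ^ 2 := by
    rw [ht, Real.cos_pi_sub, Real.cos_two_mul]; linarith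
  have hsin : Real.sin t = 2 * Real.sin z.arg * Real.cos z.arg := by
    rw [ht, Real.sin_pi_sub, Real.sin_two_mul]
  rw [planeRot_apply hv hvw, refl_apply, hm, Real.cos_sub_int_mul_two_pi,
    Real.sin_sub_int_mul_two_pi, ← hre, ← him, hcos, hsin]
  generalize Real.cos z.arg = c at *
  generalize Real.sin z.arg = s at *
  have h4 : s ^ 2 = 1 - c ^ 2 := by linarith
  rw [sub_eq_add_neg, add_assoc]
  congr 1
  match_scalars
  · linear_combination (‖z‖ * c) * hs
  · linear_combination (-‖z‖ * s) * hs

theorem dist_planeRot_le {v w : V} (hv : ‖v‖ = 1) (hw : ‖w‖ = 1) (hvw : inner ℝ v w = 0)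
    (s t : ℝ) (x : V) : dist (planeRot v w s x) (planeRot v w t x) ≤ 4 * |s - t| * ‖x‖ := by
  have ha : |inner ℝ v x| ≤ ‖x‖ := by simpa [hv] using abs_real_inner_le_norm v x
  have hb : |inner ℝ w x| ≤ ‖x‖ := by simpa [hw] using abs_real_inner_le_norm w x
  have hc : |Real.cos s - Real.cos t| ≤ |s - t| := Real.abs_cos_sub_cos_le s t
  have hs : |Real.sin s - Real.sin t| ≤ |s - t| := Real.abs_sin_sub_sin_le s t
  have e : planeRot v w s x - planeRot v w t x =
      ((Real.cos s - Real.cos t) * inner ℝ v x - (Real.sin s - Real.sin t) * inner ℝ w x) • v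
      + ((Real.sin s - Real.sin t) * inner ℝ v x + (Real.cos s - Real.cos t) * inner ℝ w x) • w := by
    rw [planeRot_apply hv hvw, planeRot_apply hv hvw]
    module
  have m1 := mul_le_mul hc ha (abs_nonneg _) (abs_nonneg _)
  have m2 := mul_le_mul hs hb (abs_nonneg _) (abs_nonneg _)
  have m3 := mul_le_mul hs ha (abs_nonneg _) (abs_nonneg _)
  have m4 := mul_le_mul hc hb (abs_nonneg _) (abs_nonneg _)
  rw [← abs_mul] at m1 m2 m3 m4
  rw [dist_eq_norm, e]
  refine (norm_add_le _ _).trans ?_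
  rw [norm_smul, norm_smul, hv, hw, mul_one, mul_one, Real.norm_eq_abs, Real.norm_eq_abs]
  have n1 := abs_sub ((Real.cos s - Real.cos t) * inner ℝ v x)
    ((Real.sin s - Real.sin t) * inner ℝ w x)
  have n2 := abs_add_le ((Real.sin s - Real.sin t) * inner ℝ v x)
    ((Real.cos s - Real.cos t) * inner ℝ w x)
  linarith

end averaging

end BodyVal

namespace BodyVal

section simplexVanishing

variable {V : Type*} [NormedAddCommGroup V] [InnerProductSpace ℝ V]

theorem IsAnti.planeRot_image {e : V} {ψ : Set V → ℝ} (h : IsAnti e ψ) {v w : V} (hv : ‖v‖ = 1)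
    (hw : ‖w‖ = 1) (hvw : inner ℝ v w = 0) (hve : inner ℝ v e = 0) (hwe : inner ℝ w e = 0)
    (t : ℝ) {A : Set V} (hA : CC A) : ψ (planeRot v w t '' A) = ψ A := by
  rw [planeRot, LinearMap.coe_comp, Set.image_comp,
    h.anti _ (planeRot_norm_unit hv hw hvw _) (by
      simp [inner_add_left, inner_smul_left, hve, hwe]) _ (hA.image _ (refl_continuous v)),
    h.anti v hv hve A hA, neg_neg]

theorem CC.finset_sum {ι : Type*} (s : Finset ι) {F : ι → Set V} (hF : ∀ i, CC (F i)) :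
    CC (∑ i ∈ s, F i) := by
  classical
  induction s using Finset.induction_on with
  | empty => rw [Finset.sum_empty, ← Set.singleton_zero]; exact CC.singleton 0
  | insert a s ha ih => rw [Finset.sum_insert ha]; exact (hF a).add ih

theorem nonempty_finset_sum {ι : Type*} (s : Finset ι) {F : ι → Set V}
    (hF : ∀ i, (F i).Nonempty) : (∑ i ∈ s, F i).Nonempty := by
  classical
  induction s using Finset.induction_on with
  | empty => simp
  | insert a s ha ih => rw [Finset.sum_insert ha]; exact (hF a).add ih

theorem norm_le_of_mem_sum {F : ℕ → Set V} {R : ℝ} (hF : ∀ i, ∀ x ∈ F i, ‖x‖ ≤ R) (N : ℕ) :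
    ∀ x ∈ ∑ i ∈ Finset.range N, F i, ‖x‖ ≤ N * R := by
  induction N with
  | zero => intro x hx; simp at hx; simp [hx]
  | succ N ih =>
    intro x hx
    rw [Finset.sum_range_succ] at hx
    obtain ⟨a, ha, b, hb, rfl⟩ := hx
    push_cast
    have := ih a ha
    have := hF N b hb
    have := norm_add_le a b
    linarith

variable (v w : V) (D : Set V)

/-- The Minkowski average of the images of `D` under the rotations by multiples of
`2 π / 2 ^ n`. -/
def rotAvg (n : ℕ) : Set V :=
  ((2 : ℝ) ^ n)⁻¹ • ∑ i ∈ Finset.range (2 ^ n), planeRot v w (i * (2 * Real.pi / 2 ^ n)) '' D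

variable {v w D}

theorem CC.rotAvg (hD : CC D) (n : ℕ) : CC (rotAvg v w D n) :=
  (CC.finset_sum _ fun _ => hD.image _ (continuous_planeRot _ _ _)).smul _

theorem rotAvg_nonempty (hD : D.Nonempty) (n : ℕ) : (rotAvg v w D n).Nonempty :=
  (nonempty_finset_sum _ fun _ => hD.image _).smul_set

theorem norm_le_of_mem_rotAvg (hv : ‖v‖ = 1) (hw : ‖w‖ = 1) (hvw : inner ℝ v w = 0) {R : ℝ}
    (hR : ∀ x ∈ D, ‖x‖ ≤ R) (n : ℕ) : ∀ x ∈ rotAvg v w D n, ‖x‖ ≤ R := by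
  rintro _ ⟨x, hx, rfl⟩
  have := norm_le_of_mem_sum (R := R) (by
    rintro i _ ⟨y, hy, rfl⟩
    rw [norm_planeRot hv hw hvw]
    exact hR y hy) (2 ^ n) x hx
  simp only [norm_smul, norm_inv, norm_pow, Real.norm_ofNat]
  rw [inv_mul_le_iff₀ (by positivity)]
  exact_mod_cast this

theorem image_rotAvg (hv : ‖v‖ = 1) (hw : ‖w‖ = 1) (hvw : inner ℝ v w = 0) (n : ℕ) :
    planeRot v w (2 * Real.pi / 2 ^ n) '' rotAvg v w D n = rotAvg v w D n := by
  rw [rotAvg, image_smul_set, Set.image_finsetSum]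
  congr 1
  have h : ∀ i : ℕ, planeRot v w (2 * Real.pi / 2 ^ n) ''
      (planeRot v w (i * (2 * Real.pi / 2 ^ n)) '' D) =
      planeRot v w ((i + 1 : ℕ) * (2 * Real.pi / 2 ^ n)) '' D := by
    intro i
    rw [Set.image_image]
    refine Set.image_congr fun x _ => ?_
    rw [planeRot_add hv hw hvw]
    push_cast
    ring_nf
  simp only [h]
  set F : ℕ → Set V := fun i => planeRot v w (i * (2 * Real.pi / 2 ^ n)) '' D with hF
  have h0 : F 0 = D := by simp [hF, planeRot_apply hv hvw]
  have hN : F (2 ^ n) = D := by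
    have : ((2 ^ n : ℕ) : ℝ) * (2 * Real.pi / 2 ^ n) = 2 * Real.pi := by
      push_cast
      field_simp
    simp only [hF, this, planeRot_two_pi hv hvw, Set.image_id']
  have hpos : 0 < 2 ^ n := by positivity
  obtain ⟨N, hN'⟩ : ∃ N, 2 ^ n = N + 1 := ⟨2 ^ n - 1, by omega⟩
  change ∑ i ∈ Finset.range (2 ^ n), F (i + 1) = ∑ i ∈ Finset.range (2 ^ n), F i
  rw [hN'] at hN ⊢
  rw [Finset.sum_range_succ, Finset.sum_range_succ', hN, h0]

theorem planeRot_mul_mem_rotAvg (hv : ‖v‖ = 1) (hw : ‖w‖ = 1) (hvw : inner ℝ v w = 0) (n : ℕ)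
    {x : V} (hx : x ∈ rotAvg v w D n) (i : ℕ) :
    planeRot v w (i * (2 * Real.pi / 2 ^ n)) x ∈ rotAvg v w D n := by
  induction i with
  | zero => simpa [planeRot_apply hv hvw] using hx
  | succ i ih =>
    rw [← image_rotAvg hv hw hvw]
    refine ⟨_, ih, ?_⟩
    rw [planeRot_add hv hw hvw]
    push_cast
    ring_nf

theorem exists_mem_rotAvg_near (hv : ‖v‖ = 1) (hw : ‖w‖ = 1) (hvw : inner ℝ v w = 0) (n : ℕ)
    {x : V} (hx : x ∈ rotAvg v w D n) :
    ∃ y ∈ rotAvg v w D n, dist (refl v x) y ≤ 4 * (2 * Real.pi / 2 ^ n) * ‖x‖ := by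
  obtain ⟨t, ht, -, hxt⟩ := refl_eq_planeRot (w := w) hv hvw x
  have hpos : 0 < 2 * Real.pi / 2 ^ n := by positivity
  set s := 2 * Real.pi / 2 ^ n with hs
  refine ⟨_, planeRot_mul_mem_rotAvg hv hw hvw n hx ⌊t / s⌋₊, ?_⟩
  rw [hxt]
  refine (dist_planeRot_le hv hw hvw _ _ x).trans ?_
  have h1 := Nat.floor_le (div_nonneg ht hpos.le)
  have h2 := Nat.lt_floor_add_one (t / s)
  rw [le_div_iff₀ hpos] at h1
  rw [div_lt_iff₀ hpos] at h2
  have : |t - ⌊t / s⌋₊ * s| ≤ s := by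
    rw [abs_le]
    constructor <;> linarith
  gcongr

theorem rotAvg_eq_of_dbl {e : V} {ψ : Set V → ℝ} (h : IsAnti e ψ)
    (hd : ∀ A, CC A → dbl ψ A = 0) (hv : ‖v‖ = 1) (hw : ‖w‖ = 1) (hvw : inner ℝ v w = 0)
    (hve : inner ℝ v e = 0) (hwe : inner ℝ w e = 0)
    {m : ℕ} (f : (Fin m → ℝ) →ₗ[ℝ] V) (hf : Function.Injective f) (n : ℕ) :
    ψ (rotAvg v w (f '' ordSimplex m 0 1) n) = ψ (f '' ordSimplex m 0 1) := by
  have hcf : Continuous f := f.continuous_of_finiteDimensional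
  set D := f '' ordSimplex m 0 1 with hD
  have hDc : CC D := (CC.ordSimplex m 0 1).image f hcf
  have hDn : D.Nonempty := (ordSimplex_nonempty m 0 zero_le_one).image f
  have hsum : ∀ N : ℕ, ψ (∑ i ∈ Finset.range N, planeRot v w (i * (2 * Real.pi / 2 ^ n)) '' D)
      = N * ψ D := by
    intro N
    induction N with
    | zero =>
      rw [Finset.range_zero, Finset.sum_empty, ← Set.singleton_zero, h.point]
      simp
    | succ N ih =>
      have := add_simplex_of_dbl h.toIsContVal hd
        (planeRot v w (N * (2 * Real.pi / 2 ^ n)) ∘ₗ f)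
        ((planeRot_injective hv hw hvw _).comp hf)
        (CC.finset_sum (Finset.range N)
          (F := fun i : ℕ => planeRot v w (i * (2 * Real.pi / 2 ^ n)) '' D)
          fun _ => hDc.image _ (continuous_planeRot _ _ _))
        (nonempty_finset_sum _ fun _ => hDn.image _)
      rw [LinearMap.coe_comp, Set.image_comp, ← hD,
        h.planeRot_image hv hw hvw hve hwe _ hDc, ih] at this
      rw [Finset.sum_range_succ, this]
      push_cast
      ring
  have h1 := smul_pow_of_dbl hd (CC.rotAvg (v := v) (w := w) hDc n) n
  rw [rotAvg, smul_smul, mul_inv_cancel₀ (by positivity), one_smul, hsum] at h1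
  push_cast at h1
  rw [rotAvg]
  exact (mul_left_cancel₀ (by positivity) h1).symm

/-- A reflection-odd valuation with `ψ (2 A) = 2 ψ A` vanishes on simplices. -/
theorem IsAnti.simplex_eq_zero {e : V} {ψ : Set V → ℝ} [FiniteDimensional ℝ V] (h : IsAnti e ψ)
    (hd : ∀ A, CC A → BodyVal.dbl ψ A = 0) (hv : ‖v‖ = 1) (hw : ‖w‖ = 1) (hvw : inner ℝ v w = 0)
    (hve : inner ℝ v e = 0) (hwe : inner ℝ w e = 0)
    {m : ℕ} (f : (Fin m → ℝ) →ₗ[ℝ] V) (hf : Function.Injective f) :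
    ψ (f '' ordSimplex m 0 1) = 0 := by
  have hcf : Continuous f := f.continuous_of_finiteDimensional
  have heq := rotAvg_eq_of_dbl h hd hv hw hvw hve hwe f hf
  set D := f '' ordSimplex m 0 1 with hD
  have hDc : CC D := (CC.ordSimplex m 0 1).image f hcf
  have hDn : D.Nonempty := (ordSimplex_nonempty m 0 zero_le_one).image f
  obtain ⟨R, hR⟩ := hDc.1.isBounded.exists_norm_le
  obtain ⟨M, hM, hMn, hlim⟩ := exists_near_limit (isCompact_closedBall (0 : V) R)
    (rotAvg v w D) (CC.rotAvg hDc) (rotAvg_nonempty hDn) fun n x hx => by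
      simpa using norm_le_of_mem_rotAvg hv hw hvw hR n x hx
  have hsub : ∀ x ∈ M, refl v x ∈ M := by
    intro x hx
    refine mem_of_near hM.1.isClosed fun δ hδ => ?_
    have hlim0 : Filter.Tendsto (fun n : ℕ => 4 * (2 * Real.pi / 2 ^ n) * R) Filter.atTop
        (nhds 0) := by
      have := (((tendsto_inv_atTop_zero.comp (tendsto_pow_atTop_atTop_of_one_lt
        (one_lt_two (α := ℝ)))).const_mul (2 * Real.pi)).const_mul 4).mul_const R
      simpa [div_eq_mul_inv] using this
    obtain ⟨N, hN⟩ := Filter.eventually_atTop.1 (hlim0.eventually (gt_mem_nhds (half_pos hδ)))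
    obtain ⟨n, hn, h1, h2⟩ := hlim (δ / 4) (by positivity) N
    obtain ⟨y, hy, hxy⟩ := h1 x hx
    obtain ⟨z, hz, hyz⟩ := exists_mem_rotAvg_near hv hw hvw n hy
    obtain ⟨u, hu, huz⟩ := h2 z hz
    refine ⟨u, hu, ?_⟩
    have h3 : dist (refl v x) (refl v y) ≤ δ / 4 := by
      rw [dist_eq_norm, ← map_sub, norm_refl hv, ← dist_eq_norm]
      exact hxy
    have h4 : 4 * (2 * Real.pi / 2 ^ n) * ‖y‖ ≤ 4 * (2 * Real.pi / 2 ^ n) * R := by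
      have := norm_le_of_mem_rotAvg hv hw hvw hR n y hy
      gcongr
    have h5 := hN n hn
    have h6 := dist_triangle4 (refl v x) (refl v y) z u
    rw [dist_comm z u] at h6
    linarith
  have himg : refl v '' M = M := by
    apply Set.Subset.antisymm
    · rintro _ ⟨x, hx, rfl⟩
      exact hsub x hx
    · intro x hx
      exact ⟨_, hsub x hx, refl_refl hv x⟩
  have hM0 : ψ M = 0 := by
    have := h.anti v hv hve M hM
    rw [himg] at this
    linarith
  by_contra hne
  obtain ⟨δ, hδ, H⟩ := h.cont M hM hMn _ (abs_pos.2 hne)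
  obtain ⟨n, -, hn⟩ := hlim δ hδ 0
  have := H _ (CC.rotAvg hDc n) (rotAvg_nonempty hDn n) hn
  rw [heq, hM0, sub_zero] at this
  exact lt_irrefl _ this

end simplexVanishing

end BodyVal

namespace BodyVal

section cutting

variable {V : Type*} [NormedAddCommGroup V] [InnerProductSpace ℝ V]

/-- A set function is simple if it vanishes on compact convex sets contained in hyperplanes. -/
def IsSimple (ψ : Set V → ℝ) : Prop :=
  ∀ A : Set V, CC A → ∀ (v : V) (c : ℝ), v ≠ 0 → (∀ y ∈ A, inner ℝ v y = c) → ψ A = 0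

/-- The half-space with outer normal `p.1` and offset `p.2`. -/
def halfSp (p : V × ℝ) : Set V := {y | inner ℝ p.1 y ≤ p.2}

theorem isClosed_halfSp (p : V × ℝ) : IsClosed (halfSp p) :=
  isClosed_le (by fun_prop) continuous_const

theorem convex_halfSp (p : V × ℝ) : Convex ℝ (halfSp p) :=
  convex_halfSpace_le (innerₛₗ ℝ p.1).isLinear p.2

theorem CC.inter_halfSp {A : Set V} (hA : CC A) (p : V × ℝ) : CC (A ∩ halfSp p) :=
  hA.inter_closed (isClosed_halfSp p) (convex_halfSp p)

theorem IsVal.add_of_inter_subset {ψ : Set V → ℝ} (h : IsVal ψ) (hs : IsSimple ψ) {A B C : Set V}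
    (hA : CC A) (hB : CC B) (hC : CC C) (hU : A ∪ B = C) {v : V} {c : ℝ} (hv : v ≠ 0)
    (hI : ∀ y ∈ A ∩ B, inner ℝ v y = c) : ψ C = ψ A + ψ B := by
  have := h.add A B hA hB (by rw [hU]; exact hC.2)
  rw [hU, hs _ (hA.inter hB) v c hv hI] at this
  linarith

theorem IsVal.cut {ψ : Set V → ℝ} (h : IsVal ψ) (hs : IsSimple ψ) {A : Set V} (hA : CC A) {v : V}
    (hv : v ≠ 0) (c : ℝ) :
    ψ A = ψ (A ∩ {y | inner ℝ v y ≤ c}) + ψ (A ∩ {y | c ≤ inner ℝ v y}) := by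
  refine h.add_of_inter_subset hs (hA.inter_halfSp (v, c)) ?_ hA ?_ hv (c := c) ?_
  · exact hA.inter_closed (isClosed_le continuous_const (by fun_prop))
      (convex_halfSpace_ge (innerₛₗ ℝ v).isLinear c)
  · rw [← Set.inter_union_distrib_left]
    refine Set.inter_eq_left.2 fun y _ => ?_
    exact le_total (inner ℝ v y) c
  · rintro y ⟨⟨_, h1⟩, _, h2⟩
    exact le_antisymm h1 h2

theorem exists_halfSp_approx [CompleteSpace V] {K B : Set V} (hK : CC K) (hn : K.Nonempty)
    (hB : IsCompact B) (hKB : K ⊆ B) {δ : ℝ} (hδ : 0 < δ) :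
    ∃ l : List (V × ℝ), (∀ p ∈ l, p.1 ≠ 0 ∧ K ⊆ halfSp p) ∧
      Near δ K (B ∩ {y | ∀ p ∈ l, y ∈ halfSp p}) := by
  set C := B ∩ {y | δ ≤ Metric.infDist y K} with hC
  have hCc : IsCompact C :=
    hB.inter_right (isClosed_le continuous_const (Metric.continuous_infDist_pt K))
  have hsep : ∀ y ∈ C, ∃ p : V × ℝ, p.1 ≠ 0 ∧ K ⊆ halfSp p ∧ p.2 < inner ℝ p.1 y := by
    intro y hy
    have hyK : y ∉ K := fun h => by
      have := hy.2
      rw [Set.mem_ofPred_eq, Metric.infDist_zero_of_mem h] at this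
      linarith
    obtain ⟨f, u, hf, hu⟩ := geometric_hahn_banach_closed_point hK.2 hK.1.isClosed hyK
    obtain ⟨v, rfl⟩ := (InnerProductSpace.toDual ℝ V).surjective f
    simp only [InnerProductSpace.toDual_apply_apply] at hf hu
    refine ⟨(v, u), ?_, fun x hx => (hf x hx).le, hu⟩
    rintro (rfl : v = 0)
    obtain ⟨x, hx⟩ := hn
    have := hf x hx
    simp at this hu
    linarith
  choose! P hP1 hP2 hP3 using hsep
  obtain ⟨t, ht, hcov⟩ := hCc.elim_nhds_subcover (fun y => {z | (P y).2 < inner ℝ (P y).1 z})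
    fun y hy => (isOpen_lt continuous_const (by fun_prop)).mem_nhds (hP3 y hy)
  refine ⟨t.toList.map P, ?_, ?_, ?_⟩
  · intro p hp
    simp only [List.mem_map, Finset.mem_toList] at hp
    obtain ⟨y, hy, rfl⟩ := hp
    exact ⟨hP1 y (ht y hy), hP2 y (ht y hy)⟩
  · intro a ha
    refine ⟨a, ⟨hKB ha, fun p hp => ?_⟩, by simpa using hδ.le⟩
    simp only [List.mem_map, Finset.mem_toList] at hp
    obtain ⟨y, hy, rfl⟩ := hp
    exact hP2 y (ht y hy) ha
  · rintro b ⟨hb, hb'⟩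
    have hbC : b ∉ C := by
      intro hbC
      obtain ⟨y, hy, hby⟩ := Set.mem_iUnion₂.1 (hcov hbC)
      have h1 := hb' (P y) (List.mem_map.2 ⟨y, Finset.mem_toList.2 hy, rfl⟩)
      exact absurd (show inner ℝ (P y).1 b ≤ (P y).2 from h1) (not_le.2 hby)
    have : Metric.infDist b K < δ := by
      by_contra hlt
      exact hbC ⟨hb, not_lt.1 hlt⟩
    obtain ⟨a, ha, hab⟩ := (Metric.infDist_lt_iff hn).1 this
    exact ⟨a, ha, by rw [dist_comm]; exact hab.le⟩

theorem CC.inter_halfSp_list {A : Set V} (hA : CC A) (l : List (V × ℝ)) :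
    CC (A ∩ {y | ∀ p ∈ l, y ∈ halfSp p}) := by
  refine hA.inter_closed ?_ ?_
  · simp only [Set.ofPred_forall]
    exact isClosed_iInter fun p => isClosed_iInter fun _ => isClosed_halfSp p
  · simp only [Set.ofPred_forall]
    exact convex_iInter fun p => convex_iInter fun _ => convex_halfSp p

theorem IsContVal.comp_subtype {ψ : Set V → ℝ} (h : IsContVal ψ) (H : Submodule ℝ V) :
    IsContVal (fun A : Set H => ψ (H.subtype '' A)) := by
  refine h.comp_of_near (h.toIsVal.comp_image H.subtype H.injective_subtype
    continuous_subtype_val) (fun A hA => hA.image _ continuous_subtype_val)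
    (fun A hA => hA.image _) one_pos ?_
  intro A B δ _ _ _ hAB
  rw [one_mul]
  constructor
  · rintro _ ⟨a, ha, rfl⟩
    obtain ⟨b, hb, hab⟩ := hAB.1 a ha
    exact ⟨_, ⟨b, hb, rfl⟩, hab⟩
  · rintro _ ⟨a, ha, rfl⟩
    obtain ⟨b, hb, hab⟩ := hAB.2 a ha
    exact ⟨_, ⟨b, hb, rfl⟩, hab⟩

/-- A body in a hyperplane is, up to translation, a body in the parallel linear hyperplane. -/
theorem IsVal.exists_subtype {ψ : Set V → ℝ} (h : IsVal ψ) {A : Set V} (hA : CC A)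
    (hn : A.Nonempty) {v : V} {c : ℝ} (hv : ∀ y ∈ A, inner ℝ v y = c) :
    ∃ B : Set (ℝ ∙ v)ᗮ, CC B ∧ B.Nonempty ∧ ψ A = ψ ((ℝ ∙ v)ᗮ.subtype '' B) := by
  obtain ⟨a, ha⟩ := hn
  set H := (ℝ ∙ v)ᗮ
  have hsub : (-a +ᵥ A) ⊆ Set.range H.subtype := by
    rintro _ ⟨y, hy, rfl⟩
    refine ⟨⟨-a + y, ?_⟩, rfl⟩
    rw [Submodule.mem_orthogonal_singleton_iff_inner_right, inner_add_right, inner_neg_right,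
      hv a ha, hv y hy]
    simp
  have himg : H.subtype '' (H.subtype ⁻¹' (-a +ᵥ A)) = -a +ᵥ A := by
    rw [Set.image_preimage_eq_inter_range, Set.inter_eq_left.2 hsub]
  refine ⟨H.subtype ⁻¹' (-a +ᵥ A), ⟨?_, ?_⟩, ⟨0, a, ha, by simp⟩, ?_⟩
  · have hcl : IsClosed (H : Set V) := Submodule.isClosed_orthogonal _
    exact (hcl.isClosedEmbedding_subtypeVal).isCompact_preimage (hA.vadd (-a)).1
  · exact (hA.vadd (-a)).2.linear_preimage H.subtype
  · rw [himg, h.trans _ _ hA]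

end cutting

end BodyVal

namespace BodyVal

section simplices

variable {V : Type*} [NormedAddCommGroup V] [InnerProductSpace ℝ V]

theorem exists_normal_of_ne_top [FiniteDimensional ℝ V] {S : Submodule ℝ V} (hS : S ≠ ⊤) :
    ∃ v : V, v ≠ 0 ∧ ∀ x ∈ S, inner ℝ v x = 0 := by
  obtain ⟨v, hv, hv0⟩ := Submodule.exists_mem_ne_zero_of_ne_bot
    (mt (Submodule.orthogonal_eq_bot_iff).1 hS)
  exact ⟨v, hv0, fun x hx => by
    rw [real_inner_comm]
    exact (Submodule.mem_orthogonal S v).1 hv x hx⟩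

theorem inner_eq_of_mem_convexHull {ι : Type*} {p : ι → V} {v : V} {c : ℝ}
    (h : ∀ i, inner ℝ v (p i) = c) {x : V} (hx : x ∈ convexHull ℝ (Set.range p)) :
    inner ℝ v x = c := by
  have : convexHull ℝ (Set.range p) ⊆ {y | inner ℝ v y = c} := by
    refine convexHull_min ?_ (convex_hyperplane (innerₛₗ ℝ v).isLinear c)
    rintro _ ⟨i, rfl⟩
    exact h i
  exact this hx

/-- The edge map sending the order simplex to the simplex with vertices `p`. -/
def edgeMap {n : ℕ} (p : Fin (n + 1) → V) : (Fin n → ℝ) →ₗ[ℝ] V :=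
  Fintype.linearCombination ℝ (fun i : Fin n => p i.succ - p i.castSucc)

theorem edgeMap_apply {n : ℕ} (p : Fin (n + 1) → V) (x : Fin n → ℝ) :
    edgeMap p x = ∑ i, x i • (p i.succ - p i.castSucc) :=
  Fintype.linearCombination_apply ..

theorem sum_range_sub_smul (y : ℕ → ℝ) (P : ℕ → V) (n : ℕ) :
    ∑ k ∈ Finset.range (n + 1), (y k - y (k + 1)) • P k =
      y 0 • P 0 + ∑ k ∈ Finset.range n, y (k + 1) • (P (k + 1) - P k) - y (n + 1) • P n := by
  induction n with
  | zero => simp [sub_smul]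
  | succ n ih =>
    rw [Finset.sum_range_succ, ih, Finset.sum_range_succ _ n]
    module

theorem convexHull_eq_edgeMap_image {n : ℕ} (p : Fin (n + 1) → V) :
    convexHull ℝ (Set.range p) = p 0 +ᵥ (edgeMap p '' ordSimplex n 0 1) := by
  apply Set.Subset.antisymm
  · refine convexHull_min ?_ (((CC.ordSimplex n 0 1).2.linear_image _).vadd _)
    rintro _ ⟨k, rfl⟩
    refine ⟨_, ⟨fun i => if i.val < k.val then 1 else 0, ⟨?_, ?_, ?_⟩, rfl⟩, ?_⟩
    · intro i hi
      omega
    · intro i _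
      dsimp only
      split_ifs <;> norm_num
    · intro i j _ hij
      have : i.val ≤ j.val := hij
      dsimp only
      split_ifs
      · rfl
      · omega
      · norm_num
      · rfl
    · rw [edgeMap_apply]
      induction k using Fin.induction with
      | zero => simp
      | succ k ih =>
        have h1 : ∀ i : Fin n, (if i.val < k.succ.val then (1 : ℝ) else 0) =
            (if i.val < k.castSucc.val then 1 else 0) + if i = k then 1 else 0 := by
          intro i
          simp only [Fin.val_succ, Fin.val_castSucc, Fin.ext_iff]
          split_ifs <;> first | omega | norm_num
        simp only [h1, add_smul, Finset.sum_add_distrib, ite_smul, one_smul, zero_smul,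
          Finset.sum_ite_eq', Finset.mem_univ, if_true] at ih ⊢
        simp only [vadd_eq_add] at ih ⊢
        rw [← add_assoc, ih]
        abel
  · rintro _ ⟨_, ⟨x, hx, rfl⟩, rfl⟩
    set y : ℕ → ℝ := fun k => if k = 0 then 1 else if h : k - 1 < n then x ⟨k - 1, h⟩ else 0
      with hy
    have hxs : ∀ i : Fin n, y (i.val + 1) = x i := by
      intro i
      simp [hy, i.2]
    have hy0 : y 0 = 1 := rfl
    have hyn : y (n + 1) = 0 := by simp [hy]
    have hanti : ∀ k, k < n + 1 → y (k + 1) ≤ y k := by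
      intro k hk
      rcases k with _ | k
      · by_cases h : 0 < n
        · simpa [hy, h] using (hx.2.1 ⟨0, h⟩ (Nat.zero_le _)).2
        · simp [hy, h]
      · by_cases h : k + 1 < n
        · have h' : k < n := by omega
          have := hx.2.2 ⟨k, h'⟩ ⟨k + 1, h⟩ (Nat.zero_le _) (by simp)
          simpa [hy, h, h'] using this
        · have h' : k < n := by omega
          have := (hx.2.1 ⟨k, h'⟩ (Nat.zero_le _)).1
          simpa [hy, h, h'] using this
    set P : ℕ → V := fun k => if h : k < n + 1 then p ⟨k, h⟩ else 0 with hP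
    have hPk : ∀ k : Fin (n + 1), P k = p k := by
      intro k
      simp only [hP, k.2, dif_pos]
    have hsum : p 0 +ᵥ edgeMap p x = ∑ k : Fin (n + 1), (y k - y (k + 1)) • p k := by
      have e1 : ∑ k : Fin (n + 1), (y k - y (k + 1)) • p k =
          ∑ k ∈ Finset.range (n + 1), (y k - y (k + 1)) • P k := by
        rw [← Fin.sum_univ_eq_sum_range (fun k => (y k - y (k + 1)) • P k)]
        simp only [hPk]
      rw [e1, sum_range_sub_smul, hyn, hy0, zero_smul, sub_zero, one_smul, edgeMap_apply,
        ← Fin.sum_univ_eq_sum_range (fun k => y (k + 1) • (P (k + 1) - P k)), vadd_eq_add]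
      have e2 : P 0 = p 0 := hPk 0
      rw [e2]
      congr 1
      refine Finset.sum_congr rfl fun i _ => ?_
      rw [hxs, ← hPk i.succ, ← hPk i.castSucc]
      simp
    change p 0 +ᵥ edgeMap p x ∈ _
    rw [hsum]
    refine (convex_convexHull ℝ _).sum_mem (fun k _ => ?_) ?_
      (fun k _ => subset_convexHull ℝ _ ⟨k, rfl⟩)
    · have := hanti k k.2
      linarith
    · rw [Fin.sum_univ_eq_sum_range (fun k => y k - y (k + 1)), Finset.sum_range_sub', hy0, hyn,
        sub_zero]

theorem CC.convexHull_range {n : ℕ} (p : Fin n → V) : CC (convexHull ℝ (Set.range p)) :=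
  ⟨(Set.finite_range p).isCompact_convexHull (𝕜 := ℝ), convex_convexHull ℝ _⟩

theorem simplex_eq_zero_of_simple [FiniteDimensional ℝ V] {ψ : Set V → ℝ} (h : IsVal ψ)
    (hs : IsSimple ψ) (h0 : ∀ (m : ℕ) (f : (Fin m → ℝ) →ₗ[ℝ] V), Function.Injective f →
      ψ (f '' ordSimplex m 0 1) = 0)
    (p : Fin (Module.finrank ℝ V + 1) → V) : ψ (convexHull ℝ (Set.range p)) = 0 := by
  by_cases hsurj : Function.Surjective (edgeMap p)
  · have hinj : Function.Injective (edgeMap p) :=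
      (LinearMap.injective_iff_surjective_of_finrank_eq_finrank (by simp)).2 hsurj
    rw [convexHull_eq_edgeMap_image, h.trans _ _
      ((CC.ordSimplex _ 0 1).image _ (LinearMap.continuous_of_finiteDimensional _)), h0 _ _ hinj]
  · obtain ⟨v, hv, hvx⟩ := exists_normal_of_ne_top (mt LinearMap.range_eq_top.1 hsurj)
    refine hs _ (CC.convexHull_range p) v (inner ℝ v (p 0)) hv fun y hy => ?_
    rw [convexHull_eq_edgeMap_image] at hy
    obtain ⟨_, ⟨x, -, rfl⟩, rfl⟩ := hy
    change inner ℝ v (p 0 + edgeMap p x) = _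
    rw [inner_add_right, hvx _ ⟨x, rfl⟩, add_zero]

theorem exists_normal_of_not_affineIndependent [FiniteDimensional ℝ V]
    {p : Fin (Module.finrank ℝ V + 1) → V} (hp : ¬ AffineIndependent ℝ p) :
    ∃ v : V, v ≠ 0 ∧ ∀ i, inner ℝ v (p i) = inner ℝ v (p 0) := by
  have h1 : vectorSpan ℝ (Set.range p) ≠ ⊤ := by
    intro htop
    apply hp
    rw [affineIndependent_iff_finrank_vectorSpan_eq ℝ p (Fintype.card_fin _), htop, finrank_top]
  obtain ⟨v, hv, hvx⟩ := exists_normal_of_ne_top h1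
  refine ⟨v, hv, fun i => ?_⟩
  have := hvx _ (vsub_mem_vectorSpan ℝ (Set.mem_range_self i) (Set.mem_range_self 0))
  rw [vsub_eq_sub, inner_sub_right] at this
  linarith

end simplices

end BodyVal

namespace BodyVal

section simpleValuations

variable {V : Type*} [NormedAddCommGroup V] [InnerProductSpace ℝ V]

theorem convexHull_update_subset {ι : Type*} [DecidableEq ι] {p : ι → V} (i : ι) {q : V}
    (hq : q ∈ convexHull ℝ (Set.range p)) :
    convexHull ℝ (Set.range (Function.update p i q)) ⊆ convexHull ℝ (Set.range p) := by
  refine convexHull_min ?_ (convex_convexHull ℝ _)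
  rintro _ ⟨k, rfl⟩
  by_cases h : k = i
  · subst h
    simpa using hq
  · rw [Function.update_of_ne h]
    exact subset_convexHull ℝ _ ⟨k, rfl⟩

theorem mem_convexHull_update {ι : Type*} [DecidableEq ι] [Fintype ι] {p : ι → V} {i j : ι}
    (hij : i ≠ j) {s t : ℝ} (hs : 0 < s) (hst : s + t = 1) {w : ι → ℝ}
    (hw : ∀ k, 0 ≤ w k) (hw1 : ∑ k, w k = 1) (hle : t * w i ≤ s * w j) :
    ∑ k, w k • p k ∈ convexHull ℝ (Set.range (Function.update p i (s • p i + t • p j))) := by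
  set p' := Function.update p i (s • p i + t • p j) with hp'
  set w' : ι → ℝ := fun k => w k + (if k = i then w i / s - w i else 0)
    - (if k = j then t * w i / s else 0) with hw'
  have hsum : ∑ k, w k • p k = ∑ k, w' k • p' k := by
    have e : ∀ k, w' k • p' k = w k • p k + ((if k = i then (w i / s) • (s • p i + t • p j)
        - w i • p i else 0) - (if k = j then (t * w i / s) • p j else 0)) := by
      intro k
      by_cases hk : k = i
      · subst hk
        simp [hw', hp', hij]
      · by_cases hk' : k = j
        · subst hk'
          simp only [hw', hp', hk, sub_eq_add_neg, if_true, if_false, add_zero, ne_eq,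
            not_false_eq_true, Function.update_of_ne, zero_add]
          module
        · simp [hw', hp', hk, hk']
    simp only [e, Finset.sum_add_distrib, Finset.sum_sub_distrib, Finset.sum_ite_eq',
      Finset.mem_univ, if_true]
    have : (w i / s) • (s • p i + t • p j) - w i • p i - (t * w i / s) • p j = 0 := by
      match_scalars <;> field_simp <;> ring
    rw [this, add_zero]
  rw [hsum]
  refine (convex_convexHull ℝ _).sum_mem (fun k _ => ?_) ?_
    (fun k _ => subset_convexHull ℝ _ ⟨k, rfl⟩)
  · by_cases hk : k = i
    · subst hk
      have := div_nonneg (hw k) hs.le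
      simpa [hw', hij] using this
    · by_cases hk' : k = j
      · subst hk'
        have : t * w i / s ≤ w k := by rw [div_le_iff₀ hs]; linarith
        simpa [hw', hk] using this
      · simpa [hw', hk, hk'] using hw k
  · simp only [hw', Finset.sum_add_distrib, Finset.sum_sub_distrib, Finset.sum_ite_eq',
      Finset.mem_univ, if_true, hw1]
    have : t = 1 - s := by linarith
    rw [this]
    field_simp
    ring

theorem convexHull_eq_union_update {ι : Type*} [DecidableEq ι] [Fintype ι] {p : ι → V} {i j : ι}
    (hij : i ≠ j) {s t : ℝ} (hs : 0 < s) (ht : 0 < t) (hst : s + t = 1) :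
    convexHull ℝ (Set.range (Function.update p i (s • p i + t • p j))) ∪
      convexHull ℝ (Set.range (Function.update p j (s • p i + t • p j))) =
      convexHull ℝ (Set.range p) := by
  have hq : s • p i + t • p j ∈ convexHull ℝ (Set.range p) :=
    convex_convexHull ℝ _ (subset_convexHull ℝ _ (Set.mem_range_self i))
      (subset_convexHull ℝ _ (Set.mem_range_self j))
      hs.le ht.le hst
  apply Set.Subset.antisymm
  · exact Set.union_subset (convexHull_update_subset i hq) (convexHull_update_subset j hq)
  · intro x hx
    rw [convexHull_range_eq_exists_affineCombination] at hx
    obtain ⟨S, w, hw, hw1, rfl⟩ := hx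
    set w' : ι → ℝ := fun k => if k ∈ S then w k else 0 with hw'
    have h1 : ∑ k, w' k = 1 := by simp [hw', Finset.sum_ite_mem, hw1]
    have h2 : S.affineCombination ℝ p w = ∑ k, w' k • p k := by
      rw [Finset.affineCombination_eq_linear_combination _ _ _ hw1]
      simp [hw', ite_smul, Finset.sum_ite_mem]
    have h0 : ∀ k, 0 ≤ w' k := by
      intro k
      by_cases hk : k ∈ S
      · simpa [hw', hk] using hw k hk
      · simp [hw', hk]
    rw [h2]
    rcases le_total (t * w' i) (s * w' j) with hle | hle
    · exact Or.inl (mem_convexHull_update hij hs hst h0 h1 hle)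
    · right
      rw [add_comm (s • p i)]
      exact mem_convexHull_update hij.symm ht (by linarith) h0 h1 hle

theorem exists_normal_update [FiniteDimensional ℝ V] {p : Fin (Module.finrank ℝ V + 1) → V}
    (hp : AffineIndependent ℝ p) {i j : Fin (Module.finrank ℝ V + 1)} (hij : i ≠ j) {s t : ℝ}
    (hs : 0 < s) (ht : 0 < t) (hst : s + t = 1) :
    ∃ (v : V) (c : ℝ), v ≠ 0 ∧
      (∀ y ∈ convexHull ℝ (Set.range (Function.update p i (s • p i + t • p j))) ∩
        convexHull ℝ (Set.range (Function.update p j (s • p i + t • p j))), inner ℝ v y = c) := by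
  have htop : affineSpan ℝ (Set.range p) = ⊤ := by
    rw [hp.affineSpan_eq_top_iff_card_eq_finrank_add_one, Fintype.card_fin]
  set b : AffineBasis _ ℝ V := ⟨p, hp, htop⟩ with hb
  have hbp : ∀ k, b k = p k := fun k => rfl
  set g : V →ᵃ[ℝ] ℝ := t • b.coord i - s • b.coord j with hg
  have hgp : ∀ k, g (p k) = t * (if i = k then 1 else 0) - s * (if j = k then 1 else 0) := by
    intro k
    simp only [← hbp, hg, AffineMap.coe_sub, AffineMap.coe_smul, Pi.sub_apply, Pi.smul_apply,
      b.coord_apply, smul_eq_mul]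
  have hgq : g (s • p i + t • p j) = 0 := by
    rw [Convex.combo_affine_apply hst, hgp, hgp]
    simp [hij, hij.symm]
    ring
  have hle : convexHull ℝ (Set.range (Function.update p i (s • p i + t • p j))) ⊆
      g ⁻¹' Set.Iic 0 := by
    refine convexHull_min ?_ ((convex_Iic (0 : ℝ)).affine_preimage g)
    rintro _ ⟨k, rfl⟩
    by_cases hk : k = i
    · subst hk
      simp [hgq]
    · have hk' : i ≠ k := fun h => hk h.symm
      simp only [Set.mem_preimage, Set.mem_Iic, Function.update_of_ne hk, hgp, if_neg hk']
      split_ifs <;> linarith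
  have hge : convexHull ℝ (Set.range (Function.update p j (s • p i + t • p j))) ⊆
      g ⁻¹' Set.Ici 0 := by
    refine convexHull_min ?_ ((convex_Ici (0 : ℝ)).affine_preimage g)
    rintro _ ⟨k, rfl⟩
    by_cases hk : k = j
    · subst hk
      simp [hgq]
    · have hk' : j ≠ k := fun h => hk h.symm
      simp only [Set.mem_preimage, Set.mem_Ici, Function.update_of_ne hk, hgp, if_neg hk']
      split_ifs <;> linarith
  set v : V := (InnerProductSpace.toDual ℝ V).symm (LinearMap.toContinuousLinearMap g.linear)
    with hv
  have hvg : ∀ y, inner ℝ v y = g y - g 0 := by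
    intro y
    rw [hv, InnerProductSpace.toDual_symm_apply]
    have := g.linearMap_vsub y 0
    simpa using this
  refine ⟨v, - g 0, ?_, fun y hy => ?_⟩
  · intro h0
    have h1 := hvg (p i)
    have h2 := hvg (p j)
    rw [h0, inner_zero_left, hgp] at h1 h2
    simp [hij, hij.symm] at h1 h2
    linarith
  · have h1 : g y ≤ 0 := hle hy.1
    have h2 : 0 ≤ g y := hge hy.2
    rw [hvg]
    linarith

theorem inter_eq_zero_of_simple [FiniteDimensional ℝ V] {ψ : Set V → ℝ} (h : IsVal ψ)
    (hs : IsSimple ψ) (p : V × ℝ) (hp0 : p.1 ≠ 0) {G : Set V} (hG : IsClosed G)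
    (hG' : Convex ℝ G)
    (h0 : ∀ x : Fin (Module.finrank ℝ V + 1) → V, ψ (convexHull ℝ (Set.range x) ∩ G) = 0) :
    ∀ x : Fin (Module.finrank ℝ V + 1) → V,
      ψ (convexHull ℝ (Set.range x) ∩ (G ∩ halfSp p)) = 0 := by
  suffices H : ∀ (N : ℕ) (x : Fin (Module.finrank ℝ V + 1) → V),
      (Finset.univ.filter fun i => inner ℝ p.1 (x i) ≠ p.2).card = N →
      ψ (convexHull ℝ (Set.range x) ∩ (G ∩ halfSp p)) = 0 from fun x => H _ x rfl
  have hcc : ∀ x : Fin (Module.finrank ℝ V + 1) → V,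
      CC (convexHull ℝ (Set.range x) ∩ (G ∩ halfSp p)) := fun x =>
    (CC.convexHull_range x).inter_closed (hG.inter (isClosed_halfSp p))
      (hG'.inter (convex_halfSp p))
  intro N
  induction N using Nat.strong_induction_on with
  | _ N ih =>
  intro x hN
  by_cases hle : ∀ i, inner ℝ p.1 (x i) ≤ p.2
  · have hsub : convexHull ℝ (Set.range x) ⊆ halfSp p := by
      refine convexHull_min ?_ (convex_halfSp p)
      rintro _ ⟨i, rfl⟩
      exact hle i
    have : convexHull ℝ (Set.range x) ∩ (G ∩ halfSp p) = convexHull ℝ (Set.range x) ∩ G := by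
      ext y
      exact ⟨fun hy => ⟨hy.1, hy.2.1⟩, fun hy => ⟨hy.1, hy.2, hsub hy.1⟩⟩
    rw [this, h0]
  by_cases hge : ∀ i, p.2 ≤ inner ℝ p.1 (x i)
  · have hsub : convexHull ℝ (Set.range x) ⊆ {y | p.2 ≤ inner ℝ p.1 y} := by
      refine convexHull_min ?_ (convex_halfSpace_ge (innerₛₗ ℝ p.1).isLinear p.2)
      rintro _ ⟨i, rfl⟩
      exact hge i
    exact hs _ (hcc x) p.1 p.2 hp0 fun y hy => le_antisymm hy.2.2 (hsub hy.1)
  push Not at hle hge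
  obtain ⟨i, hi⟩ := hle
  obtain ⟨j, hj⟩ := hge
  by_cases hind : AffineIndependent ℝ x
  swap
  · obtain ⟨v, hv, hvx⟩ := exists_normal_of_not_affineIndependent hind
    exact hs _ (hcc x) v _ hv fun y hy => inner_eq_of_mem_convexHull hvx hy.1
  have hij : i ≠ j := by
    rintro rfl
    linarith
  set a := inner ℝ p.1 (x i) - p.2 with ha
  set b := p.2 - inner ℝ p.1 (x j) with hb
  have ha0 : 0 < a := by linarith
  have hb0 : 0 < b := by linarith
  set s := b / (a + b) with hs'
  set t := a / (a + b) with ht'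
  have hs0 : 0 < s := by positivity
  have ht0 : 0 < t := by positivity
  have hst : s + t = 1 := by rw [hs', ht']; field_simp; ring
  have hq : inner ℝ p.1 (s • x i + t • x j) = p.2 := by
    rw [inner_add_right, inner_smul_right, inner_smul_right,
      show inner ℝ p.1 (x i) = p.2 + a by linarith, show inner ℝ p.1 (x j) = p.2 - b by linarith]
    rw [hs', ht']
    field_simp
    ring
  have hcard : ∀ k, inner ℝ p.1 (x k) ≠ p.2 →
      (Finset.univ.filter fun l => inner ℝ p.1 (Function.update x k (s • x i + t • x j) l)
        ≠ p.2).card < N := by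
    intro k hk
    rw [← hN]
    refine Finset.card_lt_card ?_
    rw [Finset.ssubset_iff_of_subset]
    · refine ⟨k, by simpa using hk, by simpa using hq⟩
    · intro l
      simp only [Finset.mem_filter, Finset.mem_univ, true_and]
      by_cases hlk : l = k
      · subst hlk
        simp [hq]
      · simp [hlk]
  obtain ⟨v, c, hv, hvc⟩ := exists_normal_update hind hij hs0 ht0 hst
  rw [h.add_of_inter_subset hs (hcc (Function.update x i (s • x i + t • x j)))
    (hcc (Function.update x j (s • x i + t • x j))) (hcc x) ?_ hv (c := c) ?_,
    ih _ (hcard i hi.ne') _ rfl, ih _ (hcard j hj.ne) _ rfl, add_zero]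
  · rw [← Set.union_inter_distrib_right, convexHull_eq_union_update hij hs0 ht0 hst]
  · rintro y ⟨h1, h2⟩
    exact hvc y ⟨h1.1, h2.1⟩

theorem exists_simplex_superset [FiniteDimensional ℝ V] {K : Set V} (hK : IsCompact K) :
    ∃ x : Fin (Module.finrank ℝ V + 1) → V, K ⊆ convexHull ℝ (Set.range x) := by
  obtain ⟨b, hb, -⟩ := exists_mem_interior_convexHull_affineBasis (E := V) (x := 0)
    Filter.univ_mem
  obtain ⟨ε, hε, hball⟩ := Metric.mem_nhds_iff.1 (mem_interior_iff_mem_nhds.1 hb)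
  obtain ⟨R, hR0, hR⟩ := hK.isBounded.exists_pos_norm_le
  refine ⟨fun i => (2 * R / ε) • b i, ?_⟩
  have hpos : 0 < 2 * R / ε := by positivity
  have : Set.range (fun i => (2 * R / ε) • b i) = (2 * R / ε) • Set.range b := by
    rw [← Set.image_smul, ← Set.range_comp]
    rfl
  rw [this, convexHull_smul]
  intro y hy
  rw [Set.mem_smul_set_iff_inv_smul_mem₀ hpos.ne']
  apply hball
  rw [mem_ball_zero_iff, norm_smul, norm_inv, Real.norm_of_nonneg hpos.le,
    inv_mul_lt_iff₀ hpos]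
  have := hR y hy
  have e : 2 * R / ε * ε = 2 * R := by field_simp
  rw [e]
  linarith

theorem IsContVal.eq_zero_of_simple [FiniteDimensional ℝ V] {ψ : Set V → ℝ} (h : IsContVal ψ)
    (hs : IsSimple ψ) (h0 : ∀ (m : ℕ) (f : (Fin m → ℝ) →ₗ[ℝ] V), Function.Injective f →
      ψ (f '' ordSimplex m 0 1) = 0) {A : Set V} (hA : CC A) : ψ A = 0 := by
  rcases A.eq_empty_or_nonempty with rfl | hn
  · exact h.empty
  obtain ⟨x, hx⟩ := exists_simplex_superset hA.1
  have hl : ∀ l : List (V × ℝ), (∀ p ∈ l, p.1 ≠ 0) → ∀ x : Fin (Module.finrank ℝ V + 1) → V,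
      ψ (convexHull ℝ (Set.range x) ∩ {y | ∀ p ∈ l, y ∈ halfSp p}) = 0 := by
    intro l
    induction l with
    | nil =>
      intro _ x
      simpa using simplex_eq_zero_of_simple h.toIsVal hs h0 x
    | cons p l ih =>
      intro hl x
      have hcl := (CC.inter_halfSp_list (CC.singleton (0 : V)) l)
      have e : {y : V | ∀ q ∈ p :: l, y ∈ halfSp q} = {y | ∀ q ∈ l, y ∈ halfSp q} ∩ halfSp p := by
        ext y
        simp [and_comm]
      rw [e]
      refine inter_eq_zero_of_simple h.toIsVal hs p (hl p (by simp)) ?_ ?_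
        (ih fun q hq => hl q (by simp [hq])) x
      · simp only [Set.ofPred_forall]
        exact isClosed_iInter fun p => isClosed_iInter fun _ => isClosed_halfSp p
      · simp only [Set.ofPred_forall]
        exact convex_iInter fun p => convex_iInter fun _ => convex_halfSp p
  refine h.eq_zero_of_near hA hn fun δ hδ => ?_
  obtain ⟨l, hl1, hl2⟩ := exists_halfSp_approx hA hn (CC.convexHull_range x).1 hx hδ
  refine ⟨_, (CC.convexHull_range x).inter_halfSp_list l, ?_, hl2,
    hl l (fun p hp => (hl1 p hp).1) x⟩
  obtain ⟨a, ha⟩ := hn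
  exact ⟨a, hx ha, fun p hp => (hl1 p hp).2 ha⟩

theorem finrank_orthogonal_lt [FiniteDimensional ℝ V] {v : V} (hv : v ≠ 0) :
    Module.finrank ℝ (ℝ ∙ v)ᗮ < Module.finrank ℝ V := by
  have := Submodule.finrank_add_finrank_orthogonal (ℝ ∙ v)
  rw [finrank_span_singleton hv] at this
  omega

end simpleValuations

/-- A continuous valuation vanishing on all simplices vanishes. -/
theorem IsContVal.eq_zero_of_simplices (n : ℕ) : ∀ {V : Type*} [NormedAddCommGroup V]
    [InnerProductSpace ℝ V] [FiniteDimensional ℝ V], Module.finrank ℝ V = n →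
    ∀ {ψ : Set V → ℝ}, IsContVal ψ → (∀ (m : ℕ) (f : (Fin m → ℝ) →ₗ[ℝ] V),
      Function.Injective f → ψ (f '' ordSimplex m 0 1) = 0) → ∀ {A : Set V}, CC A → ψ A = 0 := by
  induction n using Nat.strong_induction_on with
  | _ n ih =>
  intro V _ _ _ hV ψ h h0 A hA
  refine h.eq_zero_of_simple ?_ h0 hA
  intro A hA v c hv hvA
  rcases A.eq_empty_or_nonempty with rfl | hn
  · exact h.empty
  obtain ⟨B, hB, -, hAB⟩ := h.toIsVal.exists_subtype hA hn hvA
  rw [hAB]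
  refine ih _ (hV ▸ finrank_orthogonal_lt hv) rfl (h.comp_subtype (ℝ ∙ v)ᗮ) ?_ hB
  intro m f hf
  have := h0 m ((ℝ ∙ v)ᗮ.subtype ∘ₗ f) ((Submodule.injective_subtype _).comp hf)
  rwa [LinearMap.coe_comp, Set.image_comp] at this

end BodyVal

namespace BodyVal

section antiVanish

variable {V : Type*} [NormedAddCommGroup V] [InnerProductSpace ℝ V]

theorem IsAnti.eq_zero_of_dbl_iterate [FiniteDimensional ℝ V] {e v w : V} (hv : ‖v‖ = 1)
    (hw : ‖w‖ = 1) (hvw : inner ℝ v w = 0) (hve : inner ℝ v e = 0) (hwe : inner ℝ w e = 0)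
    (N : ℕ) : ∀ {ψ : Set V → ℝ}, IsAnti e ψ → (∀ A, CC A → BodyVal.dbl^[N] ψ A = 0) →
      ∀ A, CC A → ψ A = 0 := by
  induction N with
  | zero => exact fun _ h => h
  | succ N ih =>
    intro ψ h hd A hA
    refine h.toIsContVal.eq_zero_of_simplices _ rfl (fun m f hf => ?_) hA
    exact h.simplex_eq_zero (ih h.dbl hd) hv hw hvw hve hwe f hf

theorem exists_orthonormal_pair [FiniteDimensional ℝ V] (hV : 2 ≤ Module.finrank ℝ V) :
    ∃ v w : V, ‖v‖ = 1 ∧ ‖w‖ = 1 ∧ inner ℝ v w = 0 := by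
  set b := stdOrthonormalBasis ℝ V
  refine ⟨b ⟨0, by omega⟩, b ⟨1, by omega⟩, b.orthonormal.1 _, b.orthonormal.1 _,
    b.orthonormal.2 ?_⟩
  simp

theorem dbl_iterate_image {W : Type*} [AddCommGroup W] [Module ℝ W] (f : W →ₗ[ℝ] V)
    (ψ : Set V → ℝ) (N : ℕ) :
    dbl^[N] (fun B : Set W => ψ (f '' B)) = fun B => dbl^[N] ψ (f '' B) := by
  induction N generalizing ψ with
  | zero => rfl
  | succ N ih =>
    rw [Function.iterate_succ_apply, Function.iterate_succ_apply, ← ih]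
    congr 1
    ext B
    simp only [dbl, image_smul_set]

theorem IsAnti.comp_subtype {e : V} {ψ : Set V → ℝ} (h : IsAnti e ψ) (H : Submodule ℝ V)
    [H.HasOrthogonalProjection] :
    IsAnti (H.orthogonalProjectionOnto e) (fun B : Set H => ψ (H.subtype '' B)) where
  toIsContVal := h.toIsContVal.comp_subtype H
  point := by simpa using h.point
  anti v hv hve A hA := by
    rw [Submodule.inner_orthogonalProjectionOnto_eq_of_mem_left] at hve
    rw [← h.anti v hv hve _ (hA.image _ continuous_subtype_val), Set.image_image, Set.image_image]
    exact congrArg ψ (Set.image_congr fun x _ => by simp [refl_apply])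

theorem IsSimple.dbl {ψ : Set V → ℝ} (h : IsSimple ψ) : IsSimple (dbl ψ) := by
  intro A hA v c hv hvA
  rw [BodyVal.dbl, h A hA v c hv hvA, h _ (hA.smul 2) v (2 * c) hv]
  · simp
  · rintro _ ⟨y, hy, rfl⟩
    simp [inner_smul_right, hvA y hy]

theorem IsSimple.dbl_iterate {ψ : Set V → ℝ} (h : IsSimple ψ) (N : ℕ) :
    IsSimple (BodyVal.dbl^[N] ψ) := by
  induction N with
  | zero => exact h
  | succ N ih => rw [Function.iterate_succ_apply']; exact ih.dbl

theorem ordSimplex_one : ordSimplex 1 0 1 = {x | x 0 ∈ Set.Icc (0 : ℝ) 1} := by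
  ext x
  simp [ordSimplex]

theorem image_ordSimplex_one (f : (Fin 1 → ℝ) →ₗ[ℝ] V) :
    f '' ordSimplex 1 0 1 = (fun t : ℝ => t • f 1) '' Set.Icc 0 1 := by
  rw [ordSimplex_one]
  have key : ∀ x : Fin 1 → ℝ, f x = x 0 • f 1 := by
    intro x
    rw [← map_smul]
    congr 1
    ext i
    fin_cases i
    simp
  ext y
  constructor
  · rintro ⟨x, hx, rfl⟩
    exact ⟨x 0, hx, (key x).symm⟩
  · rintro ⟨t, ht, rfl⟩
    exact ⟨fun _ => t, ht, key _⟩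

theorem ordSimplex_zero_eq : ordSimplex 0 0 1 = {0} := by
  ext x
  simp [ordSimplex, Subsingleton.elim x 0]

theorem eq_zero_of_finrank_one [FiniteDimensional ℝ V] (hV : Module.finrank ℝ V = 1)
    {ψ : Set V → ℝ} (h : IsContVal ψ) (h0 : ψ {0} = 0)
    (h1 : ∀ u : V, u ≠ 0 → ψ ((fun t : ℝ => t • u) '' Set.Icc 0 1) = 0) {A : Set V} (hA : CC A) :
    ψ A = 0 := by
  refine h.eq_zero_of_simplices _ rfl (fun m f hf => ?_) hA
  have hm : m ≤ 1 := by
    have := LinearMap.finrank_le_finrank_of_injective hf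
    rwa [hV, Module.finrank_fin_fun] at this
  interval_cases m
  · rwa [ordSimplex_zero_eq, Set.image_singleton, map_zero]
  · rw [image_ordSimplex_one]
    apply h1
    rw [Ne, ← map_zero f, hf.eq_iff]
    exact one_ne_zero

theorem CC.image_Icc (u : V) (a b : ℝ) : CC ((fun t : ℝ => t • u) '' Set.Icc a b) :=
  CC.image (W := V) (V := ℝ) ⟨isCompact_Icc, convex_Icc a b⟩ (LinearMap.toSpanSingleton ℝ V u)
    (by exact continuous_id.smul continuous_const)

theorem IsAnti.eq_zero_of_finrank_one [FiniteDimensional ℝ V] (hV : Module.finrank ℝ V = 1)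
    {ψ : Set V → ℝ} (h : IsAnti 0 ψ) {A : Set V} (hA : CC A) : ψ A = 0 := by
  refine BodyVal.eq_zero_of_finrank_one hV h.toIsContVal h.point (fun u hu => ?_) hA
  have hu' : ‖u‖ ≠ 0 := norm_ne_zero_iff.2 hu
  have hcc := CC.image_Icc u 0 1
  have h1 := h.anti (‖u‖⁻¹ • u) (by rw [norm_smul, norm_inv, norm_norm, inv_mul_cancel₀ hu'])
    (inner_zero_right _) _ hcc
  have h2 : refl (‖u‖⁻¹ • u) '' ((fun t : ℝ => t • u) '' Set.Icc 0 1) =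
      -u +ᵥ ((fun t : ℝ => t • u) '' Set.Icc 0 1) := by
    have key : ∀ t : ℝ, refl (‖u‖⁻¹ • u) (t • u) = -(t • u) := by
      intro t
      rw [refl_apply, inner_smul_left, inner_smul_right, real_inner_self_eq_norm_sq]
      simp only [conj_trivial, smul_smul]
      rw [show 2 * (‖u‖⁻¹ * (t * ‖u‖ ^ 2)) * ‖u‖⁻¹ = 2 * t by field_simp]
      module
    ext y
    constructor
    · rintro ⟨_, ⟨t, ht, rfl⟩, rfl⟩
      refine ⟨_, ⟨1 - t, ⟨by linarith [ht.2], by linarith [ht.1]⟩, rfl⟩, ?_⟩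
      rw [key]
      simp only [vadd_eq_add]
      module
    · rintro ⟨_, ⟨t, ht, rfl⟩, rfl⟩
      refine ⟨_, ⟨1 - t, ⟨by linarith [ht.2], by linarith [ht.1]⟩, rfl⟩, ?_⟩
      rw [key]
      simp only [vadd_eq_add]
      module
  rw [h2, h.trans _ _ hcc] at h1
  linarith

end antiVanish

/-- The `N`-fold doubling defect annihilates all antisymmetric valuations in dimension `n`. -/
def AntiNil.{u} (n N : ℕ) : Prop :=
  ∀ (V : Type u) [NormedAddCommGroup V] [InnerProductSpace ℝ V] [FiniteDimensional ℝ V],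
    Module.finrank ℝ V = n → ∀ (e : V) (ψ : Set V → ℝ), IsAnti e ψ →
      ∀ K, CC K → dbl^[N] ψ K = 0

theorem antiNil_one : AntiNil 1 1 := by
  intro V _ _ _ hV e ψ h K hK
  have hd := h.dbl
  refine eq_zero_of_finrank_one hV hd.toIsContVal hd.point (fun u hu => ?_) hK
  have hcc := CC.image_Icc u 0 1
  set S := (fun t : ℝ => t • u) '' Set.Icc 0 1 with hS
  have h1 : S ∪ (u +ᵥ S) = (2 : ℝ) • S := by
    ext y
    constructor
    · rintro (⟨t, ht, rfl⟩ | ⟨_, ⟨t, ht, rfl⟩, rfl⟩)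
      · refine ⟨_, ⟨t / 2, ⟨by linarith [ht.1], by linarith [ht.2]⟩, rfl⟩, ?_⟩
        simp only
        module
      · refine ⟨_, ⟨(1 + t) / 2, ⟨by linarith [ht.1], by linarith [ht.2]⟩, rfl⟩, ?_⟩
        simp only [vadd_eq_add]
        module
    · rintro ⟨_, ⟨t, ht, rfl⟩, rfl⟩
      rcases le_total t (1 / 2) with h2 | h2
      · left
        refine ⟨2 * t, ⟨by linarith [ht.1], by linarith⟩, ?_⟩
        simp only
        module
      · right
        refine ⟨_, ⟨2 * t - 1, ⟨by linarith, by linarith [ht.2]⟩, rfl⟩, ?_⟩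
        simp only [vadd_eq_add]
        module
  have h2 : S ∩ (u +ᵥ S) = {u} := by
    ext y
    constructor
    · rintro ⟨⟨t, ht, rfl⟩, ⟨_, ⟨s, hs, rfl⟩, hst⟩⟩
      have h3 : (1 + s - t) • u = 0 := by
        have : u + s • u = t • u := hst
        rw [sub_smul, ← this]
        module
      have h4 : 1 + s - t = 0 := (smul_eq_zero.1 h3).resolve_right hu
      have h5 : t = 1 := by linarith [ht.2, hs.1]
      simp [h5]
    · rintro rfl
      exact ⟨⟨1, by simp, by simp⟩, 0, ⟨0, by simp, by simp⟩, by simp⟩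
  have h3 := h.add S (u +ᵥ S) hcc (hcc.vadd u) (by rw [h1]; exact (hcc.smul 2).2)
  rw [h1, h2, h.singleton, h.trans _ _ hcc] at h3
  rw [dbl]
  linarith

theorem IsAnti.isSimple_dbl_iterate.{u} {n N : ℕ} {V : Type u} [NormedAddCommGroup V]
    [InnerProductSpace ℝ V] [FiniteDimensional ℝ V] (hn : AntiNil.{u} n N)
    (hV : Module.finrank ℝ V = n + 1) {e : V} {ψ : Set V → ℝ} (h : IsAnti e ψ) :
    IsSimple (BodyVal.dbl^[N] ψ) := by
  intro A hA v c hv hvA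
  rcases A.eq_empty_or_nonempty with rfl | hne
  · exact (h.dbl_iterate N).empty
  obtain ⟨B, hB, -, hAB⟩ := (h.dbl_iterate N).exists_subtype hA hne hvA
  rw [hAB]
  have hdim : Module.finrank ℝ (ℝ ∙ v)ᗮ = n := by
    have := Submodule.finrank_add_finrank_orthogonal (ℝ ∙ v)
    rw [finrank_span_singleton hv] at this
    omega
  have := hn (ℝ ∙ v)ᗮ hdim _ _ (h.comp_subtype _) B hB
  rwa [dbl_iterate_image] at this

end BodyVal

namespace BodyVal

section slabs

variable {V : Type*} [NormedAddCommGroup V] [InnerProductSpace ℝ V] {e : V}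

/-- The linear hyperplane orthogonal to `e`. -/
abbrev Perp (e : V) : Submodule ℝ V := (ℝ ∙ e)ᗮ

/-- The affine function with linear part `a.1` and constant term `a.2`. -/
def hgt {W : Type*} [NormedAddCommGroup W] [InnerProductSpace ℝ W] (a : W × ℝ) (x : W) : ℝ :=
  inner ℝ a.1 x + a.2

theorem continuous_hgt {W : Type*} [NormedAddCommGroup W] [InnerProductSpace ℝ W] (a : W × ℝ) :
    Continuous (hgt a) := by
  unfold hgt
  fun_prop

/-- The orthogonal projection onto the hyperplane orthogonal to `e`. -/
def hproj (e : V) : V →L[ℝ] Perp e := (Perp e).orthogonalProjectionOnto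

/-- The points lying above `Q` between the graphs of the affine functions `a` and `b`. -/
def slab (e : V) (Q : Set (Perp e)) (a b : Perp e × ℝ) : Set V :=
  {y | hproj e y ∈ Q ∧ hgt a (hproj e y) ≤ inner ℝ e y ∧ inner ℝ e y ≤ hgt b (hproj e y)}

theorem inner_hproj (x : Perp e) (y : V) : inner ℝ x (hproj e y) = inner ℝ (x : V) y :=
  Submodule.inner_orthogonalProjectionOnto_eq_of_mem_left x y

theorem inner_perp (x : Perp e) : inner ℝ e (x : V) = 0 :=
  Submodule.mem_orthogonal_singleton_iff_inner_right.1 x.2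

theorem hproj_perp (x : Perp e) : hproj e x = x :=
  Submodule.orthogonalProjectionOnto_mem_subspace_eq_self x

theorem hproj_self : hproj e e = 0 :=
  Submodule.orthogonalProjectionOnto_orthogonalComplement_singleton_eq_zero e

theorem hproj_add_smul (x : Perp e) (t : ℝ) : hproj e (x + t • e) = x := by
  rw [map_add, map_smul, hproj_perp, hproj_self, smul_zero, add_zero]

theorem inner_add_smul (he : ‖e‖ = 1) (x : Perp e) (t : ℝ) :
    inner ℝ e ((x : V) + t • e) = t := by
  rw [inner_add_right, inner_perp, inner_smul_right, real_inner_self_eq_norm_sq, he]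
  ring

theorem hproj_add_inner (he : ‖e‖ = 1) (y : V) : (hproj e y : V) + inner ℝ e y • e = y := by
  have h : y - inner ℝ e y • e ∈ Perp e := by
    rw [Submodule.mem_orthogonal_singleton_iff_inner_right, inner_sub_right, inner_smul_right,
      real_inner_self_eq_norm_sq, he]
    ring
  have h2 : y = ((⟨_, h⟩ : Perp e) : V) + inner ℝ e y • e := by simp
  have h3 : hproj e y = ⟨_, h⟩ := by
    conv_lhs => rw [h2]
    rw [hproj_add_smul]
  rw [h3]
  simp

theorem add_smul_mem_slab (he : ‖e‖ = 1) {Q : Set (Perp e)} {a b : Perp e × ℝ} {x : Perp e}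
    {t : ℝ} : (x : V) + t • e ∈ slab e Q a b ↔ x ∈ Q ∧ hgt a x ≤ t ∧ t ≤ hgt b x := by
  rw [slab, Set.mem_ofPred_eq, hproj_add_smul, inner_add_smul he]

theorem slab_empty (a b : Perp e × ℝ) : slab e ∅ a b = ∅ := by
  ext y
  simp [slab]

theorem slab_union (A B : Set (Perp e)) (a b : Perp e × ℝ) :
    slab e (A ∪ B) a b = slab e A a b ∪ slab e B a b := by
  ext y
  simp only [slab, Set.mem_ofPred_eq, Set.mem_union]
  tauto

theorem slab_inter (A B : Set (Perp e)) (a b : Perp e × ℝ) :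
    slab e (A ∩ B) a b = slab e A a b ∩ slab e B a b := by
  ext y
  simp only [slab, Set.mem_ofPred_eq, Set.mem_inter_iff]
  tauto

theorem convex_slab {Q : Set (Perp e)} (hQ : Convex ℝ Q) (a b : Perp e × ℝ) :
    Convex ℝ (slab e Q a b) := by
  have key : ∀ (a : Perp e × ℝ) (s t : ℝ) (x y : Perp e), s + t = 1 →
      hgt a (s • x + t • y) = s * hgt a x + t * hgt a y := by
    intro a s t x y hst
    simp only [hgt, inner_add_right, inner_smul_right]
    linear_combination -a.2 * hst
  rintro x ⟨h1, h2, h3⟩ y ⟨h4, h5, h6⟩ s t hs ht hst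
  refine ⟨?_, ?_, ?_⟩
  · rw [map_add, map_smul, map_smul]
    exact hQ h1 h4 hs ht hst
  all_goals
    rw [map_add, map_smul, map_smul, key _ _ _ _ _ hst, inner_add_right, inner_smul_right,
      inner_smul_right]
    gcongr

theorem CC.slab [FiniteDimensional ℝ V] (he : ‖e‖ = 1) {Q : Set (Perp e)} (hQ : CC Q)
    (a b : Perp e × ℝ) : CC (slab e Q a b) := by
  refine ⟨?_, convex_slab hQ.2 a b⟩
  refine Metric.isCompact_of_isClosed_isBounded ?_ ?_
  · refine (hQ.1.isClosed.preimage (hproj e).continuous).inter (IsClosed.inter ?_ ?_)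
    · exact isClosed_le ((continuous_hgt a).comp (hproj e).continuous) (by fun_prop)
    · exact isClosed_le (by fun_prop) ((continuous_hgt b).comp (hproj e).continuous)
  · obtain ⟨R, hR⟩ := hQ.1.isBounded.exists_norm_le
    obtain ⟨Ra, ha⟩ := (hQ.1.image (continuous_hgt a)).isBounded.exists_norm_le
    obtain ⟨Rb, hb⟩ := (hQ.1.image (continuous_hgt b)).isBounded.exists_norm_le
    refine isBounded_iff_forall_norm_le.2 ⟨R + (Ra + Rb), ?_⟩
    rintro y ⟨h1, h2, h3⟩
    have h4 := hR _ h1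
    have h5 := abs_le.1 (ha _ ⟨_, h1, rfl⟩)
    have h6 := abs_le.1 (hb _ ⟨_, h1, rfl⟩)
    have h7 : |inner ℝ e y| ≤ Ra + Rb := abs_le.2 ⟨by linarith, by linarith⟩
    calc ‖y‖ = ‖(hproj e y : V) + inner ℝ e y • e‖ := by rw [hproj_add_inner he]
      _ ≤ ‖(hproj e y : V)‖ + ‖inner ℝ e y • e‖ := norm_add_le _ _
      _ ≤ R + (Ra + Rb) := by
        rw [norm_smul, he, mul_one]
        exact add_le_add h4 h7

theorem slab_nonempty (he : ‖e‖ = 1) {Q : Set (Perp e)} (hQ : Q.Nonempty) {a b : Perp e × ℝ}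
    (hab : ∀ x ∈ Q, hgt a x ≤ hgt b x) : (slab e Q a b).Nonempty := by
  obtain ⟨x, hx⟩ := hQ
  exact ⟨_, (add_smul_mem_slab he).2 ⟨hx, le_rfl, hab x hx⟩⟩

theorem smul_slab (Q : Set (Perp e)) (a b : Perp e × ℝ) :
    (2 : ℝ) • slab e Q a b = slab e ((2 : ℝ) • Q) (a.1, 2 * a.2) (b.1, 2 * b.2) := by
  ext y
  rw [Set.mem_smul_set_iff_inv_smul_mem₀ two_ne_zero]
  simp only [slab, Set.mem_ofPred_eq, map_smul, Set.mem_smul_set_iff_inv_smul_mem₀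
    (two_ne_zero (α := ℝ)), hgt, inner_smul_right]
  refine and_congr Iff.rfl (and_congr ?_ ?_) <;> constructor <;> intro h <;> linarith

theorem vadd_slab (he : ‖e‖ = 1) (Q : Set (Perp e)) (a b : Perp e × ℝ) (x : Perp e) (t : ℝ) :
    ((x : V) + t • e) +ᵥ slab e Q a b =
      slab e (x +ᵥ Q) (a.1, a.2 - inner ℝ a.1 x + t) (b.1, b.2 - inner ℝ b.1 x + t) := by
  ext y
  simp only [Set.mem_vadd_set_iff_neg_vadd_mem, slab, Set.mem_ofPred_eq, vadd_eq_add, map_add,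
    map_neg, hproj_perp, map_smul, hproj_self, smul_zero, add_zero, hgt, inner_add_right,
    inner_neg_right, inner_smul_right, inner_perp, real_inner_self_eq_norm_sq, he]
  refine and_congr Iff.rfl (and_congr ?_ ?_) <;> constructor <;> intro h <;> linarith

theorem image_refl_slab (he : ‖e‖ = 1) (Q : Set (Perp e)) {a b : Perp e × ℝ} {v : Perp e}
    (ha : inner ℝ v a.1 = 0) (hb : inner ℝ v b.1 = 0) :
    refl (v : V) '' slab e Q a b = slab e (refl v '' Q) a b := by
  have key : ∀ (x : Perp e) (t : ℝ), refl (v : V) (x + t • e) = (refl v x : V) + t • e := by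
    intro x t
    simp only [refl_apply, inner_add_right, inner_smul_right, real_inner_comm e (v : V),
      inner_perp]
    simp only [mul_zero, add_zero, Submodule.coe_sub, Submodule.coe_smul, Submodule.coe_inner]
    module
  have hh : ∀ c : Perp e × ℝ, inner ℝ v c.1 = 0 → ∀ x, hgt c (refl v x) = hgt c x := by
    intro c hc x
    simp only [hgt, refl_apply, inner_sub_right, inner_smul_right, real_inner_comm v c.1, hc]
    ring
  ext y
  constructor
  · rintro ⟨y, hy, rfl⟩
    rw [← hproj_add_inner he y, add_smul_mem_slab he] at hy
    rw [← hproj_add_inner he y, key, add_smul_mem_slab he, hh a ha, hh b hb]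
    exact ⟨⟨_, hy.1, rfl⟩, hy.2⟩
  · intro hy
    rw [← hproj_add_inner he y, add_smul_mem_slab he] at hy
    obtain ⟨⟨x, hx, hxy⟩, h⟩ := hy
    rw [← hxy, hh a ha, hh b hb] at h
    refine ⟨_, (add_smul_mem_slab he).2 ⟨hx, h⟩, ?_⟩
    rw [key, hxy, hproj_add_inner he]

theorem hgt_le_add {W : Type*} [NormedAddCommGroup W] [InnerProductSpace ℝ W] (a : W × ℝ)
    (x y : W) : hgt a x ≤ hgt a y + ‖a.1‖ * dist x y := by
  have : inner ℝ a.1 (x - y) ≤ ‖a.1‖ * ‖x - y‖ := real_inner_le_norm _ _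
  rw [inner_sub_right] at this
  rw [dist_eq_norm]
  simp only [hgt]
  linarith

theorem exists_mem_slab_near (he : ‖e‖ = 1) {Q Q' : Set (Perp e)} {a b : Perp e × ℝ} {δ : ℝ}
    (hab : ∀ x ∈ Q', hgt a x ≤ hgt b x) (hQ : ∀ x ∈ Q, ∃ x' ∈ Q', dist x x' ≤ δ) {y : V}
    (hy : y ∈ slab e Q a b) :
    ∃ y' ∈ slab e Q' a b, dist y y' ≤ (1 + ‖a.1‖ + ‖b.1‖) * δ := by
  rw [← hproj_add_inner he y, add_smul_mem_slab he] at hy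
  obtain ⟨h1, h2, h3⟩ := hy
  obtain ⟨x', hx', hd⟩ := hQ _ h1
  set x := hproj e y
  set z := inner ℝ e y
  have ha1 := hgt_le_add a x' x
  have hb1 := hgt_le_add b x x'
  rw [dist_comm x' x] at ha1
  have ha2 : ‖a.1‖ * dist x x' ≤ ‖a.1‖ * δ := by gcongr
  have hb2 : ‖b.1‖ * dist x x' ≤ ‖b.1‖ * δ := by gcongr
  have hδ : 0 ≤ δ := dist_nonneg.trans hd
  have ha3 : 0 ≤ ‖a.1‖ * δ := by positivity
  have hb3 : 0 ≤ ‖b.1‖ * δ := by positivity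
  have hab' := hab x' hx'
  set z' := max (hgt a x') (min z (hgt b x')) with hz'
  have hz : |z - z'| ≤ ‖a.1‖ * δ + ‖b.1‖ * δ := by
    rw [abs_le, hz']
    rcases le_total z (hgt b x') with h | h
    · rw [min_eq_left h]
      rcases le_total (hgt a x') z with h' | h'
      · rw [max_eq_right h']
        constructor <;> linarith
      · rw [max_eq_left h']
        constructor <;> linarith
    · rw [min_eq_right h, max_eq_right hab']
      constructor <;> linarith
  refine ⟨(x' : V) + z' • e, (add_smul_mem_slab he).2 ⟨hx', le_max_left _ _,
    max_le hab' (min_le_right _ _)⟩, ?_⟩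
  rw [← hproj_add_inner he y]
  calc dist ((x : V) + z • e) ((x' : V) + z' • e)
      ≤ dist (x : V) (x' : V) + dist (z • e) (z' • e) := dist_add_add_le _ _ _ _
    _ ≤ δ + (‖a.1‖ * δ + ‖b.1‖ * δ) := by
      refine add_le_add hd ?_
      rwa [dist_eq_norm, ← sub_smul, norm_smul, he, mul_one]
    _ = _ := by ring

theorem Near.slab (he : ‖e‖ = 1) {Q Q' : Set (Perp e)} {a b : Perp e × ℝ} {δ : ℝ}
    (hab : ∀ x ∈ Q, hgt a x ≤ hgt b x) (hab' : ∀ x ∈ Q', hgt a x ≤ hgt b x) (h : Near δ Q Q') :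
    Near ((1 + ‖a.1‖ + ‖b.1‖) * δ) (slab e Q a b) (slab e Q' a b) := by
  refine ⟨fun y hy => exists_mem_slab_near he hab' h.1 hy, fun y hy => ?_⟩
  obtain ⟨y', hy', hd⟩ := exists_mem_slab_near he hab (fun x hx => by
    obtain ⟨x', hx', hd⟩ := h.2 x hx
    exact ⟨x', hx', by rwa [dist_comm]⟩) hy
  exact ⟨y', hy', by rwa [dist_comm]⟩

end slabs

end BodyVal

namespace BodyVal

section columns

variable {V : Type*} [NormedAddCommGroup V] [InnerProductSpace ℝ V] {e : V}

theorem CC.inter_hgt_le {W : Type*} [NormedAddCommGroup W] [InnerProductSpace ℝ W] {Q : Set W}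
    (hQ : CC Q) (a b : W × ℝ) : CC (Q ∩ {x | hgt a x ≤ hgt b x}) := by
  refine hQ.inter_closed (isClosed_le (continuous_hgt a) (continuous_hgt b)) ?_
  have : {x | hgt a x ≤ hgt b x} = {x | inner ℝ (a.1 - b.1) x ≤ b.2 - a.2} := by
    ext x
    simp only [hgt, Set.mem_ofPred_eq, inner_sub_left]
    constructor <;> intro h <;> linarith
  rw [this]
  exact convex_halfSpace_le (innerₛₗ ℝ (a.1 - b.1)).isLinear _

theorem Perp.finrank [FiniteDimensional ℝ V] (he : ‖e‖ = 1) :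
    Module.finrank ℝ (Perp e) + 1 = Module.finrank ℝ V := by
  have := Submodule.finrank_add_finrank_orthogonal (ℝ ∙ e)
  rw [finrank_span_singleton (by rintro rfl; simp at he)] at this
  exact (add_comm _ _).trans this

theorem IsVal.slab_add_slab [FiniteDimensional ℝ V] (he : ‖e‖ = 1) {ψ : Set V → ℝ} (h : IsVal ψ)
    (hs : IsSimple ψ) {Q : Set (Perp e)} (hQ : CC Q) {a b c : Perp e × ℝ}
    (hab : ∀ x ∈ Q, hgt a x ≤ hgt b x) (hbc : ∀ x ∈ Q, hgt b x ≤ hgt c x) :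
    ψ (slab e Q a c) = ψ (slab e Q a b) + ψ (slab e Q b c) := by
  refine h.add_of_inter_subset hs (hQ.slab he a b) (hQ.slab he b c) (hQ.slab he a c) ?_
    (v := e - (b.1 : V)) (c := b.2) ?_ ?_
  · ext y
    constructor
    · rintro (⟨h1, h2, h3⟩ | ⟨h1, h2, h3⟩)
      · exact ⟨h1, h2, h3.trans (hbc _ h1)⟩
      · exact ⟨h1, (hab _ h1).trans h2, h3⟩
    · rintro ⟨h1, h2, h3⟩
      rcases le_total (inner ℝ e y) (hgt b (hproj e y)) with h4 | h4
      · exact Or.inl ⟨h1, h2, h4⟩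
      · exact Or.inr ⟨h1, h4, h3⟩
  · intro h0
    have : inner ℝ e (e - (b.1 : V)) = 1 := by
      rw [inner_sub_right, inner_perp, real_inner_self_eq_norm_sq, he]
      norm_num
    rw [h0, inner_zero_right] at this
    exact zero_ne_one this
  · rintro y ⟨⟨_, _, h1⟩, ⟨_, h2, _⟩⟩
    have h3 := le_antisymm h1 h2
    rw [hgt, inner_hproj] at h3
    rw [inner_sub_left, h3]
    ring

theorem IsVal.slab_add_inter [FiniteDimensional ℝ V] (he : ‖e‖ = 1) {ψ : Set V → ℝ}
    (h : IsVal ψ) {A B : Set (Perp e)} (hA : CC A) (hB : CC B) (hAB : Convex ℝ (A ∪ B))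
    (a b : Perp e × ℝ) :
    ψ (slab e (A ∪ B) a b) + ψ (slab e (A ∩ B) a b) = ψ (slab e A a b) + ψ (slab e B a b) := by
  rw [slab_union, slab_inter]
  refine h.add _ _ (hA.slab he a b) (hB.slab he a b) ?_
  rw [← slab_union]
  exact convex_slab hAB a b

theorem slab_zero_eq_zero [FiniteDimensional ℝ V] (he : ‖e‖ = 1) {ψ : Set V → ℝ}
    (hs : IsSimple ψ) (hdim : 0 < Module.finrank ℝ (Perp e)) (a b : Perp e × ℝ) :
    ψ (slab e {0} a b) = 0 := by
  have : Nontrivial (Perp e) := Module.finrank_pos_iff.1 hdim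
  obtain ⟨v, hv⟩ := exists_ne (0 : Perp e)
  refine hs _ ((CC.singleton (0 : Perp e)).slab he a b) v 0 (by simpa using hv) fun y hy => ?_
  rw [← inner_hproj, hy.1, inner_zero_right]

theorem IsAnti.prism [FiniteDimensional ℝ V] (he : ‖e‖ = 1)
    (hdim : 0 < Module.finrank ℝ (Perp e)) {ψ : Set V → ℝ} (h : IsAnti e ψ) (hs : IsSimple ψ)
    {c d : ℝ} (hcd : c ≤ d) :
    IsAnti (0 : Perp e) (fun Q => ψ (slab e Q (0, c) (0, d))) where
  toIsContVal := by
    have hle : ∀ x : Perp e, hgt (0, c) x ≤ hgt (0, d) x := fun x => by simpa [hgt] using hcd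
    refine h.toIsContVal.comp_of_near ⟨?_, ?_, ?_⟩ (fun A hA => hA.slab he _ _)
      (fun A hA => slab_nonempty he hA fun x _ => hle x) (M := 1 + ‖(0 : Perp e)‖ + ‖(0 : Perp e)‖)
      (by positivity) fun A B δ _ _ _ hAB => hAB.slab he (fun x _ => hle x) (fun x _ => hle x)
    · rw [slab_empty, h.empty]
    · exact fun A B hA hB hAB => h.toIsVal.slab_add_inter he hA hB hAB _ _
    · intro x A hA
      have := vadd_slab he A (0, c) (0, d) x 0
      rw [← h.trans _ _ (hA.slab he (0, c) (0, d)), this]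
      simp
  point := slab_zero_eq_zero he hs hdim _ _
  anti v hv _ A hA := by
    rw [← h.anti v hv (by rw [real_inner_comm, inner_perp]) _ (hA.slab he _ _),
      image_refl_slab he A (inner_zero_right v) (inner_zero_right v)]

theorem IsAnti.prism_eq_zero.{u} {V : Type u} [NormedAddCommGroup V] [InnerProductSpace ℝ V]
    {e : V} [FiniteDimensional ℝ V] (he : ‖e‖ = 1) {n N : ℕ} (hn : AntiNil.{u} n N)
    (hn0 : 0 < n) (hdim : Module.finrank ℝ (Perp e) = n) {ψ : Set V → ℝ} (h : IsAnti e ψ)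
    (hs : IsSimple ψ) {c d : ℝ} (hcd : c ≤ d) {Q : Set (Perp e)} (hQ : CC Q) :
    ψ (slab e Q (0, c) (0, d)) = 0 := by
  have hp := h.prism he (hdim ▸ hn0) hs hcd
  by_cases hn1 : n = 1
  · exact hp.eq_zero_of_finrank_one (hdim.trans hn1) hQ
  · obtain ⟨v, w, hv, hw, hvw⟩ := exists_orthonormal_pair (V := Perp e) (by omega)
    exact hp.eq_zero_of_dbl_iterate hv hw hvw (inner_zero_right v) (inner_zero_right w) N
      (hn _ hdim _ _ hp) Q hQ

/-- The minimum of a linear functional on a compact set. -/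
def lowest {W : Type*} [NormedAddCommGroup W] [InnerProductSpace ℝ W] (b : W) (Q : Set W) : ℝ :=
  sInf ((fun x => inner ℝ b x) '' Q)

theorem lowest_le {W : Type*} [NormedAddCommGroup W] [InnerProductSpace ℝ W] (b : W) {Q : Set W}
    (hQ : CC Q) {x : W} (hx : x ∈ Q) : lowest b Q ≤ inner ℝ b x :=
  csInf_le (hQ.1.image (f := fun x => inner ℝ b x) (by fun_prop)).bddBelow ⟨x, hx, rfl⟩

theorem lowest_smul {W : Type*} [NormedAddCommGroup W] [InnerProductSpace ℝ W] (b : W)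
    (Q : Set W) : lowest b ((2 : ℝ) • Q) = 2 * lowest b Q := by
  rw [lowest, lowest, ← smul_eq_mul, ← Real.sInf_smul_of_nonneg (by norm_num)]
  congr 1
  exact image_smul_set (innerₛₗ ℝ b) 2 Q

/-- The valuation on the hyperplane orthogonal to `e` given by truncated columns. -/
def column (ψ : Set V → ℝ) (b : Perp e) (Q : Set (Perp e)) : ℝ :=
  ψ (slab e Q (0, lowest b Q) (b, 0))

theorem dbl_column (ψ : Set V → ℝ) (b : Perp e) : dbl (column ψ b) = column (dbl ψ) b := by
  ext Q
  simp only [dbl, column, smul_slab, lowest_smul, mul_zero]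

theorem dbl_iterate_column (ψ : Set V → ℝ) (b : Perp e) (N : ℕ) :
    dbl^[N] (column ψ b) = column (dbl^[N] ψ) b := by
  induction N with
  | zero => rfl
  | succ N ih => rw [Function.iterate_succ_apply', Function.iterate_succ_apply', ih, dbl_column]

variable [FiniteDimensional ℝ V]

/-- The property that all prisms are annihilated. -/
def PrismZero (e : V) (ψ : Set V → ℝ) : Prop :=
  ∀ (c d : ℝ), c ≤ d → ∀ Q : Set (Perp e), CC Q → ψ (slab e Q (0, c) (0, d)) = 0

theorem column_eq (he : ‖e‖ = 1) {ψ : Set V → ℝ} (h : IsVal ψ) (hs : IsSimple ψ)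
    (hp : PrismZero e ψ) {b : Perp e} {Q : Set (Perp e)} (hQ : CC Q) {c : ℝ}
    (hc : ∀ x ∈ Q, c ≤ inner ℝ b x) : column ψ b Q = ψ (slab e Q (0, c) (b, 0)) := by
  rcases Q.eq_empty_or_nonempty with rfl | hn
  · rw [column, slab_empty, slab_empty]
  have hle : c ≤ lowest b Q := by
    refine le_csInf (hn.image _) ?_
    rintro _ ⟨x, hx, rfl⟩
    exact hc x hx
  rw [column, h.slab_add_slab he hs hQ (a := (0, c)) (b := (0, lowest b Q)), hp _ _ hle _ hQ,
    zero_add]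
  · intro x _
    simpa [hgt] using hle
  · intro x hx
    simpa [hgt] using lowest_le b hQ hx

theorem IsAnti.column (he : ‖e‖ = 1) (hdim : 0 < Module.finrank ℝ (Perp e)) {ψ : Set V → ℝ}
    (h : IsAnti e ψ) (hs : IsSimple ψ) (hp : PrismZero e ψ) (b : Perp e) :
    IsAnti b (BodyVal.column ψ b) where
  empty := by rw [BodyVal.column, slab_empty, h.empty]
  add A B hA hB hAB := by
    have hU : CC (A ∪ B) := ⟨hA.1.union hB.1, hAB⟩
    have hc : ∀ x ∈ A ∪ B, lowest b (A ∪ B) ≤ inner ℝ b x := fun x hx => lowest_le b hU hx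
    rw [column_eq he h.toIsVal hs hp hU hc,
      column_eq he h.toIsVal hs hp (hA.inter hB) (fun x hx => hc x (Or.inl hx.1)),
      column_eq he h.toIsVal hs hp hA (fun x hx => hc x (Or.inl hx)),
      column_eq he h.toIsVal hs hp hB (fun x hx => hc x (Or.inr hx))]
    exact h.toIsVal.slab_add_inter he hA hB hAB _ _
  trans x A hA := by
    rw [column_eq he h.toIsVal hs hp (hA.vadd x) (c := lowest b A + inner ℝ b x), BodyVal.column,
      ← h.trans ((x : V) + inner ℝ b x • e) _ (hA.slab he _ _), vadd_slab he]
    · simp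
    · rintro _ ⟨y, hy, rfl⟩
      have := lowest_le b hA hy
      change _ ≤ inner ℝ b (x + y)
      rw [inner_add_right]
      linarith
  cont A hA hAn ε hε := by
    obtain ⟨R, hR⟩ := hA.1.isBounded.exists_norm_le
    have hc : ∀ x : Perp e, ‖x‖ ≤ R + 1 → -(‖b‖ * (R + 1)) ≤ inner ℝ b x := by
      intro x hx
      have h1 := (abs_le.1 (abs_real_inner_le_norm b x)).1
      have h2 : ‖b‖ * ‖x‖ ≤ ‖b‖ * (R + 1) := by gcongr
      linarith
    set c := -(‖b‖ * (R + 1))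
    have hcA : ∀ x ∈ A, c ≤ inner ℝ b x := fun x hx => hc x ((hR x hx).trans (by linarith))
    have hh : ∀ x : Perp e, c ≤ inner ℝ b x → hgt (0, c) x ≤ hgt (b, 0) x := by
      intro x hx
      simpa [hgt] using hx
    obtain ⟨δ, hδ, H⟩ := h.cont _ (hA.slab he (0, c) (b, 0))
      (slab_nonempty he hAn fun x hx => hh x (hcA x hx)) ε hε
    have hM : 0 < 1 + ‖((0 : Perp e), c).1‖ + ‖(b, (0 : ℝ)).1‖ := by positivity
    refine ⟨min 1 (δ / (1 + ‖((0 : Perp e), c).1‖ + ‖(b, (0 : ℝ)).1‖)), by positivity,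
      fun B hB hBn hAB => ?_⟩
    have hcB : ∀ x ∈ B, c ≤ inner ℝ b x := by
      intro x hx
      obtain ⟨a, ha, hax⟩ := hAB.2 x hx
      have h1 := hax.trans (min_le_left _ _)
      rw [dist_eq_norm, norm_sub_rev] at h1
      have h2 := norm_le_norm_add_norm_sub a x
      have h3 := hR a ha
      rw [norm_sub_rev] at h2
      exact hc x (by linarith)
    rw [column_eq he h.toIsVal hs hp hA hcA, column_eq he h.toIsVal hs hp hB hcB]
    refine H _ (hB.slab he _ _) (slab_nonempty he hBn fun x hx => hh x (hcB x hx)) ?_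
    refine (hAB.slab he (fun x hx => hh x (hcA x hx)) (fun x hx => hh x (hcB x hx))).mono ?_
    calc _ ≤ (1 + ‖((0 : Perp e), c).1‖ + ‖(b, (0 : ℝ)).1‖) *
          (δ / (1 + ‖((0 : Perp e), c).1‖ + ‖(b, (0 : ℝ)).1‖)) := by
          gcongr
          exact min_le_right _ _
      _ = δ := mul_div_cancel₀ _ hM.ne'
  point := slab_zero_eq_zero he hs hdim _ _
  anti v hv hvb A hA := by
    rw [column_eq he h.toIsVal hs hp (hA.image _ (refl_continuous v)) (c := lowest b A),
      BodyVal.column, ← h.anti v hv (by rw [real_inner_comm, inner_perp]) _ (hA.slab he _ _),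
      image_refl_slab he A (inner_zero_right v) hvb]
    rintro _ ⟨x, hx, rfl⟩
    rw [refl_apply, inner_sub_right, inner_smul_right, real_inner_comm v b, hvb, mul_zero,
      sub_zero]
    exact lowest_le b hA hx

theorem slab_eq_zero_of_column (he : ‖e‖ = 1) {ψ : Set V → ℝ} (h : IsVal ψ) (hs : IsSimple ψ)
    (hp : PrismZero e ψ) (hcol : ∀ b Q, CC Q → column (e := e) ψ b Q = 0) {Q : Set (Perp e)}
    (hQ : CC Q) (a b : Perp e × ℝ) : ψ (slab e Q a b) = 0 := by
  have key : ∀ (Q : Set (Perp e)), CC Q → ∀ (b : Perp e × ℝ) (c : ℝ), (∀ x ∈ Q, c ≤ hgt b x) →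
      ψ (slab e Q (0, c) b) = 0 := by
    intro Q hQ b c hc
    have h1 := vadd_slab he Q (0, c) b 0 (-b.2)
    simp only [inner_zero_right, sub_zero, zero_vadd, add_neg_cancel] at h1
    rw [← h.trans _ _ (hQ.slab he _ _), h1, ← column_eq he h hs hp hQ, hcol _ _ hQ]
    intro x hx
    have := hc x hx
    rw [hgt] at this
    linarith
  set Q' := Q ∩ {x | hgt a x ≤ hgt b x} with hQ'
  have hQc : CC Q' := hQ.inter_hgt_le a b
  have hQe : slab e Q a b = slab e Q' a b := by
    ext y
    exact ⟨fun hy => ⟨⟨hy.1, hy.2.1.trans hy.2.2⟩, hy.2⟩, fun hy => ⟨hy.1.1, hy.2⟩⟩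
  obtain ⟨c, hc⟩ := (hQc.1.image (continuous_hgt a)).bddBelow
  have hca : ∀ x ∈ Q', c ≤ hgt a x := fun x hx => hc ⟨x, hx, rfl⟩
  have := h.slab_add_slab he hs hQc (a := (0, c)) (b := a) (c := b)
    (fun x hx => by simpa [hgt] using hca x hx) (fun x hx => hx.2)
  rw [key Q' hQc b c (fun x hx => (hca x hx).trans hx.2), key Q' hQc a c hca, zero_add] at this
  rw [hQe, ← this]

end columns

end BodyVal

namespace BodyVal

section polytopes

variable {V : Type*} [NormedAddCommGroup V] [InnerProductSpace ℝ V] {e : V}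

theorem inner_eq_hproj (he : ‖e‖ = 1) (p y : V) :
    inner ℝ p y = inner ℝ (hproj e p) (hproj e y) + inner ℝ e p * inner ℝ e y := by
  conv_lhs => rw [← hproj_add_inner he y]
  have h1 := inner_hproj (hproj e y) p
  rw [real_inner_comm, real_inner_comm p] at h1
  rw [inner_add_right, inner_smul_right, h1, real_inner_comm e p]
  ring

/-- Cutting a body by the vertical hyperplane over the set where two affine functions agree. -/
theorem IsVal.eq_zero_of_vertical_cut {ψ : Set V → ℝ} (h : IsVal ψ)
    (hs : IsSimple ψ) {A : Set V} (hA : CC A) (a b : Perp e × ℝ)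
    (h1 : ψ (A ∩ {y | hgt a (hproj e y) ≤ hgt b (hproj e y)}) = 0)
    (h2 : ψ (A ∩ {y | hgt b (hproj e y) ≤ hgt a (hproj e y)}) = 0) : ψ A = 0 := by
  by_cases hab : a.1 = b.1
  · rcases le_total a.2 b.2 with hle | hle
    · rwa [Set.inter_eq_left.2] at h1
      intro y _
      simpa [hgt, hab] using hle
    · rwa [Set.inter_eq_left.2] at h2
      intro y _
      simpa [hgt, hab] using hle
  · have hv : ((a.1 - b.1 : Perp e) : V) ≠ 0 := by
      rw [Ne, Submodule.coe_eq_zero]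
      exact sub_ne_zero.2 hab
    rw [h.cut hs hA hv (b.2 - a.2)]
    have e1 : {y : V | inner ℝ ((a.1 - b.1 : Perp e) : V) y ≤ b.2 - a.2} =
        {y | hgt a (hproj e y) ≤ hgt b (hproj e y)} := by
      ext y
      simp only [hgt, Set.mem_ofPred_eq, ← inner_hproj, inner_sub_left]
      constructor <;> intro h <;> linarith
    have e2 : {y : V | b.2 - a.2 ≤ inner ℝ ((a.1 - b.1 : Perp e) : V) y} =
        {y | hgt b (hproj e y) ≤ hgt a (hproj e y)} := by
      ext y
      simp only [hgt, Set.mem_ofPred_eq, ← inner_hproj, inner_sub_left]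
      constructor <;> intro h <;> linarith
    rw [e1, e2, h1, h2, add_zero]

variable [FiniteDimensional ℝ V]

theorem slab_inter_halfSp_eq_zero (he : ‖e‖ = 1) {ψ : Set V → ℝ} (h : IsVal ψ) (hs : IsSimple ψ)
    (h0 : ∀ (Q : Set (Perp e)) (a b : Perp e × ℝ), CC Q → ψ (slab e Q a b) = 0)
    (l : List (V × ℝ)) : ∀ (Q : Set (Perp e)) (a b : Perp e × ℝ), CC Q →
      ψ (slab e Q a b ∩ {y | ∀ p ∈ l, y ∈ halfSp p}) = 0 := by
  induction l with
  | nil =>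
    intro Q a b hQ
    simpa using h0 Q a b hQ
  | cons p l ih =>
    intro Q a b hQ
    have hcc : CC (slab e Q a b ∩ {y | ∀ q ∈ p :: l, y ∈ halfSp q}) :=
      (hQ.slab he a b).inter_halfSp_list _
    set s := inner ℝ e p.1 with hs'
    set w := hproj e p.1 with hw
    have hmem : ∀ y, y ∈ halfSp p ↔ inner ℝ w (hproj e y) + s * inner ℝ e y ≤ p.2 := by
      intro y
      rw [halfSp, Set.mem_ofPred_eq, inner_eq_hproj he]
    set c : Perp e × ℝ := (-(s⁻¹ • w), s⁻¹ * p.2) with hc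
    have hgc : ∀ x, hgt c x = s⁻¹ * (p.2 - inner ℝ w x) := by
      intro x
      rw [hgt, hc, inner_neg_left, inner_smul_left]
      simp only [conj_trivial]
      ring
    rcases lt_trichotomy s 0 with hs0 | hs0 | hs0
    · have hmem' : ∀ y, y ∈ halfSp p ↔ hgt c (hproj e y) ≤ inner ℝ e y := by
        intro y
        rw [hmem, hgc, inv_mul_eq_div, div_le_iff_of_neg hs0]
        constructor <;> intro h <;> linarith
      refine h.eq_zero_of_vertical_cut hs hcc a c ?_ ?_
      · rw [← ih (Q ∩ {x | hgt a x ≤ hgt c x}) c b (hQ.inter_hgt_le a c)]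
        congr 1
        ext y
        simp only [Set.mem_inter_iff, slab, Set.mem_ofPred_eq, List.forall_mem_cons, hmem']
        constructor
        · rintro ⟨⟨⟨h1, h2, h3⟩, h4, h5⟩, h6⟩
          exact ⟨⟨⟨h1, h6⟩, h4, h3⟩, h5⟩
        · rintro ⟨⟨⟨h1, h6⟩, h4, h3⟩, h5⟩
          exact ⟨⟨⟨h1, h6.trans h4, h3⟩, h4, h5⟩, h6⟩
      · rw [← ih (Q ∩ {x | hgt c x ≤ hgt a x}) a b (hQ.inter_hgt_le c a)]
        congr 1
        ext y
        simp only [Set.mem_inter_iff, slab, Set.mem_ofPred_eq, List.forall_mem_cons, hmem']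
        constructor
        · rintro ⟨⟨⟨h1, h2, h3⟩, h4, h5⟩, h6⟩
          exact ⟨⟨⟨h1, h6⟩, h2, h3⟩, h5⟩
        · rintro ⟨⟨⟨h1, h6⟩, h2, h3⟩, h5⟩
          exact ⟨⟨⟨h1, h2, h3⟩, h6.trans h2, h5⟩, h6⟩
    · set c' : Perp e × ℝ := (0, p.2) with hc'
      rw [← ih (Q ∩ {x | hgt (w, 0) x ≤ hgt c' x}) a b (hQ.inter_hgt_le _ _)]
      congr 1
      ext y
      simp only [Set.mem_inter_iff, slab, Set.mem_ofPred_eq, List.forall_mem_cons, hmem, hs0,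
        hgt, hc', inner_zero_left, zero_mul, add_zero, zero_add]
      tauto
    · have hmem' : ∀ y, y ∈ halfSp p ↔ inner ℝ e y ≤ hgt c (hproj e y) := by
        intro y
        rw [hmem, hgc, le_inv_mul_iff₀ hs0]
        constructor <;> intro h <;> linarith
      refine h.eq_zero_of_vertical_cut hs hcc b c ?_ ?_
      · rw [← ih (Q ∩ {x | hgt b x ≤ hgt c x}) a b (hQ.inter_hgt_le b c)]
        congr 1
        ext y
        simp only [Set.mem_inter_iff, slab, Set.mem_ofPred_eq, List.forall_mem_cons, hmem']
        constructor
        · rintro ⟨⟨⟨h1, h2, h3⟩, h4, h5⟩, h6⟩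
          exact ⟨⟨⟨h1, h6⟩, h2, h3⟩, h5⟩
        · rintro ⟨⟨⟨h1, h6⟩, h2, h3⟩, h5⟩
          exact ⟨⟨⟨h1, h2, h3⟩, h3.trans h6, h5⟩, h6⟩
      · rw [← ih (Q ∩ {x | hgt c x ≤ hgt b x}) a c (hQ.inter_hgt_le c b)]
        congr 1
        ext y
        simp only [Set.mem_inter_iff, slab, Set.mem_ofPred_eq, List.forall_mem_cons, hmem']
        constructor
        · rintro ⟨⟨⟨h1, h2, h3⟩, h4, h5⟩, h6⟩
          exact ⟨⟨⟨h1, h6⟩, h2, h4⟩, h5⟩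
        · rintro ⟨⟨⟨h1, h6⟩, h2, h4⟩, h5⟩
          exact ⟨⟨⟨h1, h2, h4.trans h6⟩, h4, h5⟩, h6⟩

theorem IsContVal.eq_zero_of_slab (he : ‖e‖ = 1) {ψ : Set V → ℝ} (h : IsContVal ψ)
    (hs : IsSimple ψ)
    (h0 : ∀ (Q : Set (Perp e)) (a b : Perp e × ℝ), CC Q → ψ (slab e Q a b) = 0)
    {K : Set V} (hK : CC K) : ψ K = 0 := by
  rcases K.eq_empty_or_nonempty with rfl | hn
  · exact h.empty
  obtain ⟨R, hR⟩ := hK.1.isBounded.exists_norm_le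
  set Q : Set (Perp e) := Metric.closedBall 0 R with hQ
  have hQc : CC Q := ⟨isCompact_closedBall _ _, convex_closedBall _ _⟩
  have hKB : K ⊆ slab e Q (0, -R) (0, R) := by
    intro y hy
    have h1 := hR y hy
    have h2 : |inner ℝ e y| ≤ R := (abs_real_inner_le_norm e y).trans (by rwa [he, one_mul])
    refine ⟨?_, ?_, ?_⟩
    · rw [hQ, mem_closedBall_zero_iff]
      exact ((Perp e).norm_orthogonalProjectionOnto_apply_le y).trans h1
    · simpa [hgt] using (abs_le.1 h2).1
    · simpa [hgt] using (abs_le.1 h2).2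
  refine h.eq_zero_of_near hK hn fun δ hδ => ?_
  have hB := hQc.slab he (0, -R) (0, R)
  obtain ⟨l, hl1, hl2⟩ := exists_halfSp_approx hK hn hB.1 hKB hδ
  refine ⟨_, hB.inter_halfSp_list l, ?_, hl2,
    slab_inter_halfSp_eq_zero he h.toIsVal hs h0 l _ _ _ hQc⟩
  obtain ⟨a, ha⟩ := hn
  exact ⟨a, hKB ha, fun p hp => (hl1 p hp).2 ha⟩

end polytopes

theorem exists_unit_direction {V : Type*} [NormedAddCommGroup V] [InnerProductSpace ℝ V]
    [Nontrivial V] (e : V) : ∃ (e' : V) (c : ℝ), ‖e'‖ = 1 ∧ e = c • e' := by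
  by_cases he : e = 0
  · obtain ⟨v, hv⟩ := exists_norm_eq V zero_le_one
    exact ⟨v, 0, hv, by rw [he, zero_smul]⟩
  · have : ‖e‖ ≠ 0 := norm_ne_zero_iff.2 he
    exact ⟨‖e‖⁻¹ • e, ‖e‖, by rw [norm_smul, norm_inv, norm_norm, inv_mul_cancel₀ this],
      by rw [smul_smul, mul_inv_cancel₀ this, one_smul]⟩

theorem IsAnti.of_smul {V : Type*} [NormedAddCommGroup V] [InnerProductSpace ℝ V] {e : V} {c : ℝ}
    {ψ : Set V → ℝ} (h : IsAnti (c • e) ψ) : IsAnti e ψ where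
  toIsContVal := h.toIsContVal
  point := h.point
  anti v hv hve := h.anti v hv (by rw [inner_smul_right, hve, mul_zero])

theorem AntiNil.succ.{u} {n N : ℕ} (hn0 : 0 < n) (hn : AntiNil.{u} n N) :
    AntiNil.{u} (n + 1) (N + N) := by
  intro V _ _ _ hV e₀ ψ₀ h₀ K hK
  have : Nontrivial V := Module.finrank_pos_iff.1 (by rw [hV]; omega : 0 < Module.finrank ℝ V)
  obtain ⟨e, c, he, rfl⟩ := exists_unit_direction e₀
  have h := h₀.of_smul
  have hdim : Module.finrank ℝ (Perp e) = n := by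
    have := Perp.finrank he
    omega
  have h1 := h.dbl_iterate N
  have hs1 := h.isSimple_dbl_iterate hn hV
  rw [Function.iterate_add_apply]
  set ψ := dbl^[N] ψ₀ with hψ
  have hp1 : PrismZero e ψ := fun c d hcd Q hQ => h1.prism_eq_zero he hn hn0 hdim hs1 hcd hQ
  have h2 := h1.dbl_iterate N
  have hs2 := hs1.dbl_iterate N
  have hp2 : PrismZero e (dbl^[N] ψ) :=
    fun c d hcd Q hQ => h2.prism_eq_zero he hn hn0 hdim hs2 hcd hQ
  refine h2.toIsContVal.eq_zero_of_slab he hs2 (fun Q a b hQ => ?_) hK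
  refine slab_eq_zero_of_column he h2.toIsVal hs2 hp2 (fun b Q hQ => ?_) hQ a b
  rw [← dbl_iterate_column]
  exact hn _ hdim _ _ (h1.column he (hdim ▸ hn0) hs1 hp1 b) Q hQ

theorem exists_antiNil.{u} (n : ℕ) : ∃ N, AntiNil.{u} (n + 1) N := by
  induction n with
  | zero => exact ⟨1, antiNil_one⟩
  | succ n ih =>
    obtain ⟨N, hN⟩ := ih
    exact ⟨_, hN.succ n.succ_pos⟩

/-- In dimension at least three, antisymmetric valuations vanish. -/
theorem IsAnti.eq_zero {V : Type*} [NormedAddCommGroup V] [InnerProductSpace ℝ V]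
    [FiniteDimensional ℝ V] (hV : 3 ≤ Module.finrank ℝ V) {e : V} {ψ : Set V → ℝ}
    (h₀ : IsAnti e ψ) {K : Set V} (hK : CC K) : ψ K = 0 := by
  have : Nontrivial V := Module.finrank_pos_iff.1 (by omega : 0 < Module.finrank ℝ V)
  obtain ⟨e', c, he, rfl⟩ := exists_unit_direction e
  have h := h₀.of_smul
  obtain ⟨N, hN⟩ := exists_antiNil (Module.finrank ℝ V - 1)
  obtain ⟨v, w, hv, hw, hvw⟩ := exists_orthonormal_pair (V := Perp e') (by
    have := Perp.finrank he
    omega)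
  exact h.eq_zero_of_dbl_iterate (v := (v : V)) (w := (w : V)) hv hw hvw
    (by rw [real_inner_comm, inner_perp]) (by rw [real_inner_comm, inner_perp]) N
    (hN V (by omega) _ _ h) K hK

end BodyVal

namespace BodyVal

/-- The support function of a set in direction `u`. -/
def supp {V : Type*} [NormedAddCommGroup V] [InnerProductSpace ℝ V] (A : Set V) (u : V) : ℝ :=
  sSup ((fun x => inner ℝ x u) '' A)

theorem supp_isLUB {n : ℕ} (K : Body n) (u : En n) :
    IsLUB ((fun x => inner ℝ x u) '' (K : Set (En n))) (supp (K : Set (En n)) u) :=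
  isLUB_csSup (K.nonempty.image _)
    (K.isCompact.image (by fun_prop : Continuous fun x : En n => inner ℝ x u)).bddAbove

theorem inner_le_supp {n : ℕ} (K : Body n) (u : En n) {x : En n} (hx : x ∈ (K : Set (En n))) :
    inner ℝ x u ≤ supp (K : Set (En n)) u :=
  (supp_isLUB K u).1 ⟨x, hx, rfl⟩

theorem supp_le {n : ℕ} (K : Body n) (u : En n) {c : ℝ}
    (h : ∀ x ∈ (K : Set (En n)), inner ℝ x u ≤ c) : supp (K : Set (En n)) u ≤ c :=
  (supp_isLUB K u).2 (by rintro _ ⟨x, hx, rfl⟩; exact h x hx)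

theorem supp_add {n : ℕ} (K L : Body n) (u : En n) :
    supp ((K + L : Body n) : Set (En n)) u = supp (K : Set (En n)) u + supp (L : Set (En n)) u := by
  apply le_antisymm
  · refine supp_le _ _ fun x hx => ?_
    rw [ConvexBody.coe_add] at hx
    obtain ⟨a, ha, b, hb, rfl⟩ := hx
    rw [inner_add_left]
    exact add_le_add (inner_le_supp K u ha) (inner_le_supp L u hb)
  · rw [← le_sub_iff_add_le]
    refine supp_le _ _ fun a ha => ?_
    rw [le_sub_iff_add_le, ← le_sub_iff_add_le']
    refine supp_le _ _ fun b hb => ?_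
    rw [le_sub_iff_add_le', ← inner_add_left]
    refine inner_le_supp _ u ?_
    rw [ConvexBody.coe_add]
    exact Set.add_mem_add ha hb

theorem supp_le_add_dist {n : ℕ} (K L : Body n) (u : En n) :
    supp (K : Set (En n)) u ≤ supp (L : Set (En n)) u + ‖u‖ * dist K L := by
  refine supp_le _ _ fun x hx => ?_
  obtain ⟨y, hy, hxy⟩ := L.isCompact.exists_infDist_eq_dist L.nonempty x
  have h1 := Metric.infDist_le_hausdorffDist_of_mem hx
    (ConvexBody.hausdorffEDist_ne_top (K := K) (L := L))
  rw [ConvexBody.hausdorffDist_coe, hxy, dist_eq_norm] at h1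
  have h2 := inner_le_supp L u hy
  have h3 := real_inner_le_norm (x - y) u
  rw [inner_sub_left] at h3
  nlinarith [norm_nonneg u]

theorem continuous_supp {n : ℕ} (u : En n) :
    Continuous fun K : Body n => supp (K : Set (En n)) u := by
  refine (LipschitzWith.of_dist_le_mul (K := ‖u‖₊) fun K L => ?_).continuous
  have h1 := supp_le_add_dist K L u
  have h2 := supp_le_add_dist L K u
  rw [dist_comm] at h2
  rw [Real.dist_eq, abs_le, coe_nnnorm]
  constructor <;> linarith

theorem le_of_supp_le {n : ℕ} {K L : Body n}
    (h : ∀ u, supp (K : Set (En n)) u ≤ supp (L : Set (En n)) u) :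
    (K : Set (En n)) ⊆ L := by
  intro x hx
  by_contra hxL
  obtain ⟨f, c, hf, hc⟩ := geometric_hahn_banach_closed_point L.convex L.isCompact.isClosed hxL
  set u := (InnerProductSpace.toDual ℝ (En n)).symm f with hu
  have hfu : ∀ y, f y = inner ℝ y u := fun y => by
    rw [real_inner_comm, hu, InnerProductSpace.toDual_symm_apply]
  have h1 := inner_le_supp K u hx
  have h2 : supp (L : Set (En n)) u ≤ c := supp_le _ _ fun y hy => by
    rw [← hfu]; exact (hf y hy).le
  rw [hfu] at hc
  linarith [h u]

theorem eq_of_supp_eq {n : ℕ} {K L : Body n}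
    (h : ∀ u, supp (K : Set (En n)) u = supp (L : Set (En n)) u) : K = L :=
  SetLike.coe_injective <|
    (le_of_supp_le fun u => (h u).le).antisymm (le_of_supp_le fun u => (h u).ge)

theorem coe_mapBody {n : ℕ} (A : Matrix (Fin n) (Fin n) ℝ) (K : Body n) :
    (mapBody A K : Set (En n)) = Matrix.toEuclideanLin A '' (K : Set (En n)) := rfl

theorem coe_transBody {n : ℕ} (x : En n) (K : Body n) :
    (transBody x K : Set (En n)) = x +ᵥ (K : Set (En n)) := rfl

theorem mapBody_mul {n : ℕ} (A B : Matrix (Fin n) (Fin n) ℝ) (K : Body n) :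
    mapBody (A * B) K = mapBody A (mapBody B K) := by
  apply SetLike.coe_injective
  simp only [coe_mapBody, ← Set.image_comp]
  congr 1
  funext x
  simp [Matrix.toLpLin_apply, Matrix.mulVec_mulVec]

/-- The matrix of the reflection in the hyperplane orthogonal to the unit vector `v`. -/
def reflMat {n : ℕ} (v : En n) : Matrix (Fin n) (Fin n) ℝ :=
  1 - (2 : ℝ) • Matrix.vecMulVec v.ofLp v.ofLp

theorem dotProduct_ofLp {n : ℕ} (v w : En n) : v.ofLp ⬝ᵥ w.ofLp = inner ℝ v w := by
  simp [PiLp.inner_apply, dotProduct, mul_comm]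

theorem toEuclideanLin_reflMat {n : ℕ} (v : En n) :
    Matrix.toEuclideanLin (reflMat v) = refl v := by
  ext x i
  rw [refl_apply, ← dotProduct_ofLp]
  simp [reflMat, Matrix.toLpLin_apply, Matrix.vecMulVec_mulVec]
  ring

theorem reflMat_mul_self {n : ℕ} {v : En n} (hv : ‖v‖ = 1) : reflMat v * reflMat v = 1 := by
  apply Matrix.toEuclideanLin.injective
  ext x
  simp only [Matrix.toLpLin_mul_same, toEuclideanLin_reflMat, LinearMap.comp_apply, refl_refl hv]
  simp

theorem reflMat_mem {n : ℕ} {v : En n} (hv : ‖v‖ = 1) :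
    reflMat v ∈ Matrix.orthogonalGroup (Fin n) ℝ := by
  rw [Matrix.mem_orthogonalGroup_iff]
  have : (reflMat v).transpose = reflMat v := by
    ext i j
    simp [reflMat, Matrix.vecMulVec_apply, Matrix.one_apply, eq_comm, mul_comm]
  rw [this, reflMat_mul_self hv]

theorem det_reflMat {n : ℕ} {v : En n} (hv : ‖v‖ = 1) : (reflMat v).det = -1 := by
  have h : reflMat v = 1 + Matrix.replicateCol Unit ((-2 : ℝ) • v.ofLp)
      * Matrix.replicateRow Unit v.ofLp := by
    ext i j
    simp [reflMat, Matrix.vecMulVec_apply, Matrix.mul_apply]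
    ring
  rw [h, Matrix.det_one_add_replicateCol_mul_replicateRow, dotProduct_smul, dotProduct_ofLp,
    real_inner_self_eq_norm_sq, hv]
  norm_num

theorem coe_mapBody_reflMat {n : ℕ} (v : En n) (K : Body n) :
    (mapBody (reflMat v) K : Set (En n)) = refl v '' (K : Set (En n)) := by
  rw [coe_mapBody, toEuclideanLin_reflMat]

theorem mapBody_reflMat_reflMat {n : ℕ} {v : En n} (hv : ‖v‖ = 1) (K : Body n) :
    mapBody (reflMat v) (mapBody (reflMat v) K) = K := by
  apply SetLike.coe_injective
  rw [coe_mapBody_reflMat, coe_mapBody_reflMat, image_refl_refl hv]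

theorem supp_mapBody_reflMat {n : ℕ} {u v : En n} (hvu : inner ℝ v u = 0) (K : Body n) :
    supp (mapBody (reflMat v) K : Set (En n)) u = supp (K : Set (En n)) u := by
  rw [coe_mapBody_reflMat, supp, supp, Set.image_image]
  congr 2
  funext x
  simp [refl_apply, inner_sub_left, inner_smul_left, hvu]

theorem isometry_refl {V : Type*} [NormedAddCommGroup V] [InnerProductSpace ℝ V] {v : V}
    (hv : ‖v‖ = 1) : Isometry (refl v) :=
  AddMonoidHomClass.isometry_of_norm _ (norm_refl hv)

theorem continuous_mapBody_reflMat {n : ℕ} {v : En n} (hv : ‖v‖ = 1) :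
    Continuous fun K : Body n => mapBody (reflMat v) K := by
  refine (Isometry.of_dist_eq fun K L => ?_).continuous
  rw [← ConvexBody.hausdorffDist_coe, ← ConvexBody.hausdorffDist_coe, coe_mapBody_reflMat,
    coe_mapBody_reflMat, Metric.hausdorffDist_image (isometry_refl hv)]

/-- The extension of a function on convex bodies to all sets, zero where it is undefined. -/
def extend {n : ℕ} (F : Body n → ℝ) (A : Set (En n)) : ℝ :=
  open Classical in
  if h : CC A ∧ A.Nonempty then F ⟨A, h.1.2, h.1.1, h.2⟩ else 0

theorem extend_coe {n : ℕ} (F : Body n → ℝ) (K : Body n) : extend F (K : Set (En n)) = F K :=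
  dif_pos (⟨⟨K.isCompact, K.convex⟩, K.nonempty⟩ : CC (K : Set (En n)) ∧ _)

theorem CC.exists_body {n : ℕ} {A : Set (En n)} (hA : CC A) (h : A.Nonempty) :
    ∃ K : Body n, (K : Set (En n)) = A := ⟨⟨A, hA.2, hA.1, h⟩, rfl⟩

theorem extend_empty {n : ℕ} (F : Body n → ℝ) : extend F ∅ = 0 :=
  dif_neg fun h => Set.not_nonempty_empty h.2

theorem isContVal_extend {n : ℕ} {F : Body n → ℝ} (hc : Continuous F) (hv : IsValuation F)
    (ht : IsTransInv F) : IsContVal (extend F) where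
  empty := extend_empty F
  add A B hA hB hAB := by
    rcases A.eq_empty_or_nonempty with rfl | hA'
    · simp [extend_empty]
    rcases B.eq_empty_or_nonempty with rfl | hB'
    · simp [extend_empty]
    obtain ⟨a, ha⟩ := hA'
    obtain ⟨b, hb⟩ := hB'
    obtain ⟨z, -, hz⟩ := exists_mem_segment_inter hA.1.isClosed hB.1.isClosed hAB ha hb
    obtain ⟨K, rfl⟩ := hA.exists_body ⟨a, ha⟩
    obtain ⟨L, rfl⟩ := hB.exists_body ⟨b, hb⟩
    obtain ⟨I, hI⟩ := (hA.inter hB).exists_body ⟨z, hz⟩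
    obtain ⟨U, hU⟩ := CC.exists_body ⟨hA.1.union hB.1, hAB⟩ ⟨a, Or.inl ha⟩
    rw [← hI, ← hU]
    simp only [extend_coe]
    exact (hv K L U I hU hI).symm
  trans x A hA := by
    rcases A.eq_empty_or_nonempty with rfl | hA'
    · simp
    obtain ⟨K, rfl⟩ := hA.exists_body hA'
    rw [← coe_transBody, extend_coe, extend_coe, ht]
  cont A hA hA' ε hε := by
    obtain ⟨K, rfl⟩ := hA.exists_body hA'
    obtain ⟨δ, hδ, h⟩ := Metric.continuous_iff.1 hc K ε hε
    refine ⟨δ / 2, half_pos hδ, fun B hB hB' hN => ?_⟩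
    obtain ⟨L, rfl⟩ := hB.exists_body hB'
    rw [extend_coe, extend_coe, ← Real.dist_eq]
    refine h L (lt_of_le_of_lt ?_ (half_lt_self hδ))
    rw [dist_comm, ← ConvexBody.hausdorffDist_coe]
    refine Metric.hausdorffDist_le_of_mem_dist (half_pos hδ).le hN.1 fun b hb => ?_
    obtain ⟨a, ha, hab⟩ := hN.2 b hb
    exact ⟨a, ha, by rwa [dist_comm]⟩

theorem map_mapBody {n : ℕ} {Φ : Body n → Body n} (hSO : IsSOEquivariant Φ)
    {A : Matrix (Fin n) (Fin n) ℝ} (hA : A ∈ Matrix.orthogonalGroup (Fin n) ℝ) (hd : A.det = 1)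
    (K : Body n) : Φ (mapBody A K) = mapBody A (Φ K) :=
  hSO ⟨⟨A, hA⟩, hd⟩ K

theorem map_reflMat_reflMat {n : ℕ} {Φ : Body n → Body n} (hSO : IsSOEquivariant Φ)
    {v w : En n} (hv : ‖v‖ = 1) (hw : ‖w‖ = 1) (K : Body n) :
    Φ (mapBody (reflMat v) (mapBody (reflMat w) K)) =
      mapBody (reflMat v) (mapBody (reflMat w) (Φ K)) := by
  rw [← mapBody_mul, ← mapBody_mul]
  exact map_mapBody hSO (mul_mem (reflMat_mem hv) (reflMat_mem hw))
    (by rw [Matrix.det_mul, det_reflMat hv, det_reflMat hw]; norm_num) K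

theorem mapBody_transBody {n : ℕ} (v x : En n) (K : Body n) :
    mapBody (reflMat v) (transBody x K) = transBody (refl v x) (mapBody (reflMat v) K) := by
  apply SetLike.coe_injective
  rw [coe_mapBody_reflMat, coe_transBody, coe_transBody, coe_mapBody_reflMat, image_vadd_linear]

theorem IsValuation.comp_reflMat {n : ℕ} {Φ : Body n → Body n} (hval : IsValuation Φ)
    {v : En n} (hv : ‖v‖ = 1) : IsValuation fun K => Φ (mapBody (reflMat v) K) := by
  intro K L U I hU hI
  apply hval <;> simp only [coe_mapBody_reflMat]
  · rw [hU, Set.image_union]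
  · rw [hI, Set.image_inter (isometry_refl hv).injective]

theorem IsValuation.supp {n : ℕ} {Φ : Body n → Body n} (hval : IsValuation Φ) (u : En n) :
    IsValuation fun K => supp (Φ K : Set (En n)) u := by
  intro K L U I hU hI
  simp only [← supp_add, hval K L U I hU hI]

theorem supp_map_reflMat {n : ℕ} (hn : 3 ≤ n) {Φ : Body n → Body n}
    (hcont : Continuous Φ) (hval : IsValuation Φ) (htrans : IsTransInv Φ)
    (hSO : IsSOEquivariant Φ) {u v : En n} (hv : ‖v‖ = 1) (hvu : inner ℝ v u = 0) (K : Body n) :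
    supp (Φ (mapBody (reflMat v) K) : Set (En n)) u = supp (Φ K : Set (En n)) u := by
  set F : Body n → ℝ := fun K =>
    supp (Φ K : Set (En n)) u - supp (Φ (mapBody (reflMat v) K) : Set (En n)) u with hF
  have key : ∀ w : En n, ‖w‖ = 1 → inner ℝ w u = 0 → ∀ K,
      F (mapBody (reflMat w) K) = - F K := by
    intro w hw hwu K
    have h1 : supp (Φ (mapBody (reflMat v) (mapBody (reflMat w) K)) : Set (En n)) u =
        supp (Φ K : Set (En n)) u := by
      rw [map_reflMat_reflMat hSO hv hw, supp_mapBody_reflMat hvu, supp_mapBody_reflMat hwu]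
    have h2 : supp (Φ (mapBody (reflMat w) K) : Set (En n)) u =
        supp (Φ (mapBody (reflMat v) K) : Set (En n)) u := by
      conv_lhs => rw [← mapBody_reflMat_reflMat hv K]
      rw [map_reflMat_reflMat hSO hw hv, supp_mapBody_reflMat hwu, supp_mapBody_reflMat hvu]
    simp only [hF, h1, h2, neg_sub]
  have hFc : Continuous F :=
    ((continuous_supp u).comp hcont).sub
      ((continuous_supp u).comp (hcont.comp (continuous_mapBody_reflMat hv)))
  have hFv : IsValuation F := by
    intro K L U I hU hI
    have h1 := IsValuation.supp hval u K L U I hU hI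
    have h2 := IsValuation.supp (IsValuation.comp_reflMat hval hv) u K L U I hU hI
    simp only at h1 h2
    simp only [hF]
    linarith
  have hFt : IsTransInv F := by
    intro x K
    simp only [hF, mapBody_transBody, htrans _ _]
  have hψ : IsAnti u (extend F) :=
    { isContVal_extend hFc hFv hFt with
      point := by
        obtain ⟨P, hP⟩ := CC.exists_body (CC.singleton (0 : En n)) (Set.singleton_nonempty 0)
        have : mapBody (reflMat v) P = P := by
          apply SetLike.coe_injective
          rw [coe_mapBody_reflMat, hP, Set.image_singleton, map_zero]
        rw [← hP, extend_coe]
        simp only [hF, this, sub_self]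
      anti := by
        intro w hw hwu A hA
        rcases A.eq_empty_or_nonempty with rfl | hA'
        · simp [extend_empty]
        obtain ⟨L, rfl⟩ := hA.exists_body hA'
        rw [← coe_mapBody_reflMat, extend_coe, extend_coe, key w hw hwu] }
  have h0 := hψ.eq_zero (by simpa using hn) (K := (K : Set (En n))) ⟨K.isCompact, K.convex⟩
  rw [extend_coe] at h0
  simp only [hF] at h0
  linarith

theorem exists_unit_orthogonal {n : ℕ} (hn : 3 ≤ n) (u : En n) :
    ∃ v : En n, ‖v‖ = 1 ∧ inner ℝ v u = 0 := by
  have : Nontrivial (En n) := Module.nontrivial_of_finrank_pos (R := ℝ) (by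
    rw [finrank_euclideanSpace_fin]; omega)
  obtain ⟨e, c, he, rfl⟩ := exists_unit_direction u
  have h := Perp.finrank he
  rw [finrank_euclideanSpace_fin] at h
  obtain ⟨v, -, hv, -⟩ := exists_orthonormal_pair (V := Perp e) (by omega)
  refine ⟨v, hv, ?_⟩
  rw [inner_smul_right, real_inner_comm, inner_perp, mul_zero]

theorem map_mapBody_of_det_eq_neg_one {n : ℕ} (hn : 3 ≤ n) {Φ : Body n → Body n}
    (hcont : Continuous Φ) (hval : IsValuation Φ) (htrans : IsTransInv Φ)
    (hSO : IsSOEquivariant Φ) {A : Matrix (Fin n) (Fin n) ℝ}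
    (hA : A ∈ Matrix.orthogonalGroup (Fin n) ℝ) (hd : A.det = -1) (K : Body n) :
    Φ (mapBody A K) = mapBody A (Φ K) := by
  refine eq_of_supp_eq fun u => ?_
  obtain ⟨v, hv, hvu⟩ := exists_unit_orthogonal hn u
  rw [← supp_map_reflMat hn hcont hval htrans hSO hv hvu, ← mapBody_mul,
    map_mapBody hSO (mul_mem (reflMat_mem hv) hA)
      (by rw [Matrix.det_mul, det_reflMat hv, hd]; norm_num),
    mapBody_mul, supp_mapBody_reflMat hvu]

theorem det_eq_one_or_neg_one {n : ℕ} {A : Matrix (Fin n) (Fin n) ℝ}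
    (hA : A ∈ Matrix.orthogonalGroup (Fin n) ℝ) : A.det = 1 ∨ A.det = -1 := by
  rw [Matrix.mem_orthogonalGroup_iff] at hA
  have h := congrArg Matrix.det hA
  rw [Matrix.det_mul, Matrix.det_transpose, Matrix.det_one] at h
  exact mul_self_eq_one_iff.1 h

end BodyVal

/-- **Lemma 7.1.** A continuous translation invariant Minkowski valuation which is
`SO(n)` equivariant is automatically `O(n)` equivariant. -/
theorem so_equivariant_implies_o_equivariant (n : ℕ) (hn : 3 ≤ n)
    (Φ : Body n → Body n)
    (hcont : Continuous Φ) (hval : IsValuation Φ) (htrans : IsTransInv Φ)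
    (hSO : IsSOEquivariant Φ) :
    IsOEquivariant Φ := by
  intro g K
  rcases BodyVal.det_eq_one_or_neg_one g.2 with h | h
  · exact BodyVal.map_mapBody hSO g.2 h K
  · exact BodyVal.map_mapBody_of_det_eq_neg_one hn hcont hval htrans hSO g.2 h K
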